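/- arXiv:1204.1100 — 2 statements merged into one kernel-verified Lean document; each statement's English description precedes it below -/
import Mathlib

section
/- Let X be a non-empty perfect Polish space. Then the set of balanced compact subsets of X is comeager in the hyperspace K(X) of non-empty compact subsets of X with the Hausdorff metric. -/
open Filter Set TopologicalSpace
open scoped Classical

/-- `ValidIdx a l`: the list `l` is a valid index tuple, i.e. its `k`-th entry lies in
`{0, …, a k − 1}` (representing `{1, …, a_{k+1}}` in the paper, zero-indexed). -/
def ValidIdx (a : ℕ → ℕ) (l : List ℕ) : Prop :=
  ∀ k (hk : k < l.length), l.get ⟨k, hk⟩ < a k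

/-- The distance `dist(A, B) = inf { d(x,y) : x ∈ A, y ∈ B }` of two sets. -/
noncomputable def SetDist {X : Type*} [MetricSpace X] (A B : Set X) : ℝ :=
  sInf (Set.image2 dist A B)

/-- `K` is a balanced compact set: it arises from a nested system of non-empty closed sets
`C l` (indexed by valid tuples `l`, where `l.length = n` corresponds to level `n` of the
construction) with branching numbers `a` (with `a₁ ≥ 2` and `a_{n+1} ≥ n·a₁⋯a_n`),
separation constants `b` (level-`n` sets have diameter `≤ b n` and pairwise distances
`> 2 b n`), together with an index function `Φ` (surjective onto all valid tuples, with
`Φ(2m+1)` of level `≤ 2m+1`) witnessing the odd-level separation condition (v);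
here `Φ m` stands for the value of the index function at the odd number `2m+1`. -/
def IsBalanced {X : Type*} [MetricSpace X] (K : Set X) : Prop :=
  ∃ (a : ℕ → ℕ) (C : List ℕ → Set X) (b : ℕ → ℝ) (Φ : ℕ → List ℕ),
    (∀ k, 1 ≤ a k) ∧ 2 ≤ a 0 ∧
    (∀ k, 1 ≤ k → k * ∏ i ∈ Finset.range k, a i ≤ a k) ∧
    (∀ l, ValidIdx a l → 1 ≤ l.length → (C l).Nonempty ∧ IsClosed (C l)) ∧
    (∀ l x, ValidIdx a (l ++ [x]) → 1 ≤ l.length → C (l ++ [x]) ⊆ C l) ∧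
    (∀ n, 1 ≤ n → 0 < b n) ∧
    (∀ l, ValidIdx a l → 1 ≤ l.length → Metric.diam (C l) ≤ b l.length) ∧
    (∀ l l', ValidIdx a l → ValidIdx a l' → 1 ≤ l.length → l.length = l'.length →
      l ≠ l' → 2 * b l.length < SetDist (C l) (C l')) ∧
    (∀ m, ValidIdx a (Φ m) ∧ 1 ≤ (Φ m).length ∧ (Φ m).length ≤ 2 * m + 1) ∧
    (∀ l, ValidIdx a l → 1 ≤ l.length → ∃ m, Φ m = l) ∧
    (∀ m i j, ValidIdx a i → ValidIdx a j → i.length = 2 * m + 1 → j.length = 2 * m + 1 →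
      C i ⊆ C (Φ m) → ¬ C j ⊆ C (Φ m) →
      ∀ s t, s < a (2 * m + 1) → t < a (2 * m + 1) → s ≠ t →
        Metric.diam (⋃ u ∈ Finset.range (a (2 * m + 1)), C (j ++ [u])) <
          SetDist (C (i ++ [s])) (C (i ++ [t]))) ∧
    K = ⋂ n : ℕ, ⋃ l ∈ {l : List ℕ | ValidIdx a l ∧ l.length = n + 1}, C l


/-! ### An abstract lemma producing generic branches -/

lemma generic_branch {Y St : Type*} [TopologicalSpace Y] [SecondCountableTopology Y]
    (U : ℕ → St → Set Y) (R : ℕ → St → St → Prop) (s0 : St)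
    (hopen : ∀ n σ, IsOpen (U n σ)) (h0 : U 0 s0 = univ)
    (hdense : ∀ n σ, U n σ ⊆ closure (⋃ τ ∈ {τ | R n σ τ}, U (n + 1) τ)) :
    ∀ᶠ K in residual Y, ∃ s : ℕ → St, s 0 = s0 ∧ (∀ n, R n (s n) (s (n + 1))) ∧
      ∀ n, K ∈ U n (s n) := by
  have hT : ∀ n σ, ∃ T ⊆ {τ | R n σ τ}, T.Countable ∧
      ⋃ τ ∈ T, U (n + 1) τ = ⋃ τ ∈ {τ | R n σ τ}, U (n + 1) τ := fun n σ =>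
    isOpen_biUnion_countable _ _ (fun τ _ => hopen (n + 1) τ)
  choose T hTsub hTc hTU using hT
  let Sg : ℕ → Set St := fun n => Nat.rec {s0} (fun k A => ⋃ σ ∈ A, T k σ) n
  have hSc : ∀ n, (Sg n).Countable := by
    intro n
    induction n with
    | zero => exact countable_singleton _
    | succ k ih => exact ih.biUnion (fun σ _ => hTc k σ)
  have key : ∀ n, ∀ σ ∈ Sg n, ∀ᶠ K in residual Y,
      K ∈ U n σ → ∃ τ ∈ T n σ, K ∈ U (n + 1) τ := by
    intro n σ _
    have hW : IsOpen ((⋃ τ ∈ T n σ, U (n + 1) τ) ∪ (closure (U n σ))ᶜ) :=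
      (isOpen_biUnion fun τ _ => hopen (n + 1) τ).union isClosed_closure.isOpen_compl
    have hD : Dense ((⋃ τ ∈ T n σ, U (n + 1) τ) ∪ (closure (U n σ))ᶜ) := by
      intro x
      rw [closure_union]
      by_cases hx : x ∈ closure (U n σ)
      · left
        have := hdense n σ
        rw [← hTU] at this
        exact closure_minimal this isClosed_closure hx
      · right
        exact subset_closure hx
    filter_upwards [residual_of_dense_open hW hD] with K hK hKU
    rcases hK with hK | hK
    · simpa using hK
    · exact absurd (subset_closure hKU) hK
  have key2 : ∀ᶠ K in residual Y, ∀ n, ∀ σ ∈ Sg n,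
      K ∈ U n σ → ∃ τ ∈ T n σ, K ∈ U (n + 1) τ := by
    rw [eventually_countable_forall]
    intro n
    exact (eventually_countable_ball (hSc n)).2 (key n)
  filter_upwards [key2] with K hK
  have step : ∀ n (σ : {σ // σ ∈ Sg n ∧ K ∈ U n σ}),
      ∃ τ : {τ // τ ∈ Sg (n + 1) ∧ K ∈ U (n + 1) τ}, R n σ.1 τ.1 := by
    rintro n ⟨σ, hσ, hKσ⟩
    obtain ⟨τ, hτ, hKτ⟩ := hK n σ hσ hKσ
    exact ⟨⟨τ, mem_biUnion hσ hτ, hKτ⟩, hTsub n σ hτ⟩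
  choose f hf using step
  let s : ∀ n, {σ // σ ∈ Sg n ∧ K ∈ U n σ} := fun n =>
    Nat.rec ⟨s0, mem_singleton _, by rw [h0]; trivial⟩ (fun k σ => f k σ) n
  exact ⟨fun n => (s n).1, rfl, fun n => hf n (s n), fun n => (s n).2.2⟩

/-! ### Valid indices -/

lemma ValidIdx.congr {a a' : ℕ → ℕ} {l : List ℕ} (h : ∀ k < l.length, a k = a' k)
    (hl : ValidIdx a l) : ValidIdx a' l := fun k hk => by
  rw [← h k hk]; exact hl k hk

lemma validIdx_concat {a : ℕ → ℕ} {l : List ℕ} {x : ℕ} :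
    ValidIdx a (l ++ [x]) ↔ ValidIdx a l ∧ x < a l.length := by
  constructor
  · intro h
    constructor
    · intro k hk
      have := h k (by simp; omega)
      simpa [List.getElem_append_left hk] using this
    · have := h l.length (by simp)
      simpa using this
  · rintro ⟨h1, h2⟩ k hk
    rcases Nat.lt_or_ge k l.length with h | h
    · have := h1 k h
      simpa [List.getElem_append_left h] using this
    · have hk' : k = l.length := by simp at hk; omega
      subst hk'
      simpa using h2

lemma take_isPre (n : ℕ) (l : List ℕ) : l.take n <+: l := ⟨l.drop n, List.take_append_drop n l⟩

lemma ValidIdx.take {a : ℕ → ℕ} {l : List ℕ} (h : ValidIdx a l) (n : ℕ) :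
    ValidIdx a (l.take n) := by
  intro k hk
  have := h k (by simp at hk; omega)
  simpa using this

lemma validIdx_finite (a : ℕ → ℕ) (n : ℕ) : {l : List ℕ | ValidIdx a l ∧ l.length = n}.Finite := by
  induction n with
  | zero =>
    refine (finite_singleton ([] : List ℕ)).subset ?_
    rintro l ⟨_, h⟩
    simpa using h
  | succ n ih =>
    refine (ih.image2 (fun l x => l ++ [x]) (finite_Iio (a n))).subset ?_
    rintro l ⟨hv, hl⟩
    obtain rfl | ⟨l', x, rfl⟩ := l.eq_nil_or_concat'
    · simp at hl
    · have hl' : l'.length = n := by simpa using hl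
      rw [validIdx_concat, hl'] at hv
      exact ⟨l', ⟨hv.1, hl'⟩, x, hv.2, rfl⟩

/-! ### The index function -/

/-- A sequence of lists taking every value infinitely often. -/
def phiRaw (m : ℕ) : List ℕ := (Encodable.decode (α := List ℕ) (Nat.unpair m).2).getD []

lemma phiRaw_spec (l : List ℕ) (N : ℕ) : ∃ m, N ≤ m ∧ phiRaw m = l :=
  ⟨Nat.pair N (Encodable.encode l), Nat.left_le_pair _ _, by simp [phiRaw]⟩

/-- The index function attached to the branching numbers `a`. -/
noncomputable def phiIdx (a : ℕ → ℕ) (m : ℕ) : List ℕ :=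
  if ValidIdx a (phiRaw m) ∧ 1 ≤ (phiRaw m).length ∧ (phiRaw m).length ≤ 2 * m + 1
  then phiRaw m else [0]

lemma phiIdx_congr {a a' : ℕ → ℕ} {m : ℕ} (h : ∀ k < 2 * m + 1, a k = a' k) :
    phiIdx a m = phiIdx a' m := by
  unfold phiIdx
  have : (ValidIdx a (phiRaw m) ∧ 1 ≤ (phiRaw m).length ∧ (phiRaw m).length ≤ 2 * m + 1) ↔
    (ValidIdx a' (phiRaw m) ∧ 1 ≤ (phiRaw m).length ∧ (phiRaw m).length ≤ 2 * m + 1) := by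
    constructor
    · rintro ⟨h1, h2, h3⟩
      exact ⟨h1.congr fun k hk => h k (by omega), h2, h3⟩
    · rintro ⟨h1, h2, h3⟩
      exact ⟨h1.congr fun k hk => (h k (by omega)).symm, h2, h3⟩
  simp only [this]

lemma phiIdx_valid {a : ℕ → ℕ} (ha : 1 ≤ a 0) (m : ℕ) :
    ValidIdx a (phiIdx a m) ∧ 1 ≤ (phiIdx a m).length ∧ (phiIdx a m).length ≤ 2 * m + 1 := by
  unfold phiIdx
  split_ifs with h
  · exact h
  · refine ⟨?_, by simp, by simp⟩
    intro k hk
    simp at hk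
    subst hk
    simp; omega

lemma phiIdx_surj {a : ℕ → ℕ} {l : List ℕ} (hl : ValidIdx a l) (h1 : 1 ≤ l.length) :
    ∃ m, phiIdx a m = l := by
  obtain ⟨m, hm, rfl⟩ := phiRaw_spec l l.length
  refine ⟨m, ?_⟩
  rw [phiIdx, if_pos ⟨hl, h1, by omega⟩]

/-! ### Levels of a scheme -/

/-- The finite set of valid indices of length `n`. -/
def Lev (a : ℕ → ℕ) (n : ℕ) : Set (List ℕ) := {l : List ℕ | ValidIdx a l ∧ l.length = n}

lemma mem_Lev_concat {a : ℕ → ℕ} {n : ℕ} {l : List ℕ} {x : ℕ} :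
    l ++ [x] ∈ Lev a (n + 1) ↔ l ∈ Lev a n ∧ x < a n := by
  simp only [Lev, mem_ofPred_eq, validIdx_concat, List.length_append, List.length_singleton]
  constructor
  · rintro ⟨⟨h1, h2⟩, h3⟩
    have : l.length = n := by omega
    subst this
    exact ⟨⟨h1, rfl⟩, h2⟩
  · rintro ⟨⟨h1, rfl⟩, h3⟩
    exact ⟨⟨h1, h3⟩, rfl⟩

lemma Lev_succ_cases {a : ℕ → ℕ} {n : ℕ} {l : List ℕ} (h : l ∈ Lev a (n + 1)) :
    ∃ l' x, l = l' ++ [x] ∧ l' ∈ Lev a n ∧ x < a n := by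
  obtain rfl | ⟨l', x, rfl⟩ := l.eq_nil_or_concat'
  · simp [Lev] at h
  · exact ⟨l', x, rfl, mem_Lev_concat.1 h⟩

lemma Lev_congr {a a' : ℕ → ℕ} {n : ℕ} (h : ∀ k < n, a k = a' k) : Lev a n = Lev a' n := by
  ext l
  constructor
  · rintro ⟨h1, rfl⟩
    exact ⟨h1.congr h, rfl⟩
  · rintro ⟨h1, rfl⟩
    exact ⟨h1.congr fun k hk => (h k hk).symm, rfl⟩

/-- Conditions on level `n` of a scheme. -/
structure LevelOK {X : Type*} [MetricSpace X] (a : ℕ → ℕ) (C : List ℕ → Set X) (b : ℕ → ℝ)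
    (n : ℕ) : Prop where
  bpos : 0 < b n
  bsmall : b n ≤ 1 / ((n : ℝ) + 1)
  nested : ∀ l x, l ++ [x] ∈ Lev a n → C (l ++ [x]) ⊆ C l
  nonempty : ∀ l ∈ Lev a n, (C l).Nonempty
  closed : ∀ l ∈ Lev a n, IsClosed (C l)
  small : ∀ l ∈ Lev a n, ∀ x ∈ C l, ∀ y ∈ C l, dist x y ≤ b n
  sep : ∀ l ∈ Lev a n, ∀ l' ∈ Lev a n, l ≠ l' → ∀ x ∈ C l, ∀ y ∈ C l', 3 * b n ≤ dist x y

lemma LevelOK.congr {X : Type*} [MetricSpace X] {a a' : ℕ → ℕ} {C C' : List ℕ → Set X}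
    {b b' : ℕ → ℝ} {n : ℕ} (h : LevelOK a C b n) (ha : ∀ k < n, a k = a' k)
    (hC : ∀ l : List ℕ, l.length ≤ n → C l = C' l) (hb : b n = b' n) : LevelOK a' C' b' n := by
  have hL := Lev_congr ha
  have hCL : ∀ l ∈ Lev a' n, C l = C' l := fun l hl => hC l hl.2.le
  constructor
  · rw [← hb]; exact h.bpos
  · rw [← hb]; exact h.bsmall
  · intro l x hl
    have hlen : l.length + 1 = n := by simpa using hl.2
    rw [← hCL _ hl, ← hC l (by omega)]
    exact h.nested l x (hL ▸ hl)
  · intro l hl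
    rw [← hCL _ hl]; exact h.nonempty l (hL ▸ hl)
  · intro l hl
    rw [← hCL _ hl]; exact h.closed l (hL ▸ hl)
  · intro l hl
    rw [← hCL _ hl, ← hb]; exact h.small l (hL ▸ hl)
  · intro l hl l' hl'
    rw [← hCL _ hl, ← hCL _ hl', ← hb]
    have hm : l' ∈ Lev a n := by rw [hL]; exact hl'
    exact h.sep l (hL ▸ hl) l' hm


/-- The odd-level separation condition. -/
def OddOK {X : Type*} [MetricSpace X] (a : ℕ → ℕ) (C : List ℕ → Set X) (m : ℕ) : Prop :=
  ∃ D : ℝ, 0 < D ∧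
    (∀ j ∈ Lev a (2 * m + 1), ¬ phiIdx a m <+: j → ∀ u < a (2 * m + 1), ∀ v < a (2 * m + 1),
      ∀ x ∈ C (j ++ [u]), ∀ y ∈ C (j ++ [v]), dist x y ≤ D) ∧
    (∀ i ∈ Lev a (2 * m + 1), phiIdx a m <+: i → ∀ u < a (2 * m + 1), ∀ v < a (2 * m + 1),
      u ≠ v → ∀ x ∈ C (i ++ [u]), ∀ y ∈ C (i ++ [v]), 2 * D ≤ dist x y)

lemma OddOK.congr {X : Type*} [MetricSpace X] {a a' : ℕ → ℕ} {C C' : List ℕ → Set X}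
    {m : ℕ} (h : OddOK a C m) (ha : ∀ k < 2 * m + 2, a k = a' k)
    (hC : ∀ l : List ℕ, l.length ≤ 2 * m + 2 → C l = C' l) : OddOK a' C' m := by
  obtain ⟨D, hD, h1, h2⟩ := h
  have hL : Lev a (2 * m + 1) = Lev a' (2 * m + 1) := Lev_congr fun k hk => ha k (by omega)
  have hphi : phiIdx a m = phiIdx a' m := phiIdx_congr fun k hk => ha k (by omega)
  have haa := ha (2 * m + 1) (by omega)
  rw [hL, hphi, haa] at h1 h2
  have hCC : ∀ j ∈ Lev a' (2 * m + 1), ∀ u, C (j ++ [u]) = C' (j ++ [u]) := by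
    intro j hj u
    apply hC
    simp [hj.2]
  refine ⟨D, hD, ?_, ?_⟩
  · intro j hj hn u hu v hv
    rw [← hCC j hj, ← hCC j hj]
    exact h1 j hj hn u hu v hv
  · intro j hj hn u hu v hv
    rw [← hCC j hj, ← hCC j hj]
    exact h2 j hj hn u hu v hv

/-- Growth condition on the branching numbers. -/
def GrowOK (a : ℕ → ℕ) (k : ℕ) : Prop :=
  2 ≤ a k ∧ k * ∏ i ∈ Finset.range k, a i ≤ a k

lemma GrowOK.congr {a a' : ℕ → ℕ} {k : ℕ} (h : GrowOK a k) (ha : ∀ i ≤ k, a i = a' i) :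
    GrowOK a' k := by
  unfold GrowOK
  rw [← ha k le_rfl, ← Finset.prod_congr rfl fun i hi => ha i (Finset.mem_range.1 hi).le]
  exact h

/-- Every compact set carrying a full scheme is balanced. -/
lemma isBalanced_of_scheme {X : Type*} [MetricSpace X] (K : NonemptyCompacts X)
    (a : ℕ → ℕ) (C : List ℕ → Set X) (b : ℕ → ℝ)
    (hgrow : ∀ k, GrowOK a k) (hlev : ∀ n, 1 ≤ n → LevelOK a C b n) (hodd : ∀ m, OddOK a C m)
    (hsub : ∀ n, (K : Set X) ⊆ ⋃ l ∈ Lev a (2 * n), C l)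
    (hmeet : ∀ n, ∀ l ∈ Lev a (2 * n), ((K : Set X) ∩ C l).Nonempty) :
    IsBalanced (K : Set X) := by
  have hpre : ∀ (t l : List ℕ), ValidIdx a (l ++ t) → C (l ++ t) ⊆ C l := by
    intro t
    induction t using List.reverseRecOn with
    | nil => intro l _; simp
    | append_singleton t x ih =>
      intro l hv
      rw [← List.append_assoc] at hv ⊢
      refine Subset.trans ?_ (ih l (validIdx_concat.1 hv).1)
      exact (hlev ((l ++ t) ++ [x]).length (by simp; omega)).nested _ _ ⟨hv, rfl⟩
  have hpref : ∀ l l' : List ℕ, ValidIdx a l' → l <+: l' → C l' ⊆ C l := by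
    rintro l _ hv ⟨t, rfl⟩
    exact hpre t l hv
  have hphi := phiIdx_valid (a := a) (by have := (hgrow 0).1; omega)
  refine ⟨a, C, b, phiIdx a, fun k => by have := (hgrow k).1; omega, (hgrow 0).1,
    fun k _ => (hgrow k).2, fun l hl h1 => ⟨(hlev _ h1).nonempty l ⟨hl, rfl⟩,
    (hlev _ h1).closed l ⟨hl, rfl⟩⟩, fun l x hv _ => hpre [x] l hv, fun n hn => (hlev n hn).bpos,
    ?_, ?_, hphi, fun l hl h1 => phiIdx_surj hl h1, ?_, ?_⟩
  · intro l hl h1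
    exact Metric.diam_le_of_forall_dist_le (hlev _ h1).bpos.le ((hlev _ h1).small l ⟨hl, rfl⟩)
  · intro l l' hl hl' h1 hlen hne
    have hb := (hlev _ h1).bpos
    refine lt_of_lt_of_le (by linarith : 2 * b l.length < 3 * b l.length) ?_
    refine le_csInf (((hlev _ h1).nonempty l ⟨hl, rfl⟩).image2
      ((hlev _ h1).nonempty l' ⟨hl', hlen.symm⟩)) ?_
    rintro _ ⟨x, hx, y, hy, rfl⟩
    exact (hlev _ h1).sep l ⟨hl, rfl⟩ l' ⟨hl', hlen.symm⟩ hne x hx y hy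
  · intro m i j hi hj hil hjl hCi hCj s t hs ht hst
    obtain ⟨D, hD, h1, h2⟩ := hodd m
    have hL := hlev (2 * m + 2) (by omega)
    have hjn : ¬ phiIdx a m <+: j := fun h => hCj (hpref _ _ hj h)
    have hip : phiIdx a m <+: i := by
      obtain ⟨hv, hp1, hp2⟩ := hphi m
      set k := (phiIdx a m).length with hk
      by_contra hcon
      have hne : i.take k ≠ phiIdx a m := fun h => hcon (h ▸ take_isPre _ _)
      obtain ⟨x, hx⟩ := (hlev i.length (by omega)).nonempty i ⟨hi, rfl⟩
      have hx1 : x ∈ C (i.take k) := hpref _ _ hi (take_isPre _ _) hx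
      have := (hlev k hp1).sep (i.take k) ⟨hi.take k, by simp; omega⟩ (phiIdx a m) ⟨hv, hk.symm⟩
        hne x hx1 x (hCi hx)
      rw [dist_self] at this
      linarith [(hlev k hp1).bpos]
    have hdi : Metric.diam (⋃ u ∈ Finset.range (a (2 * m + 1)), C (j ++ [u])) ≤ D := by
      apply Metric.diam_le_of_forall_dist_le hD.le
      intro x hx y hy
      simp only [mem_iUnion, Finset.mem_range] at hx hy
      obtain ⟨u, hu, hx⟩ := hx
      obtain ⟨v, hv, hy⟩ := hy
      exact h1 j ⟨hj, hjl⟩ hjn u hu v hv x hx y hy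
    refine lt_of_le_of_lt hdi (lt_of_lt_of_le (by linarith : D < 2 * D) ?_)
    refine le_csInf ((hL.nonempty _ (mem_Lev_concat.2 ⟨⟨hi, hil⟩, hs⟩)).image2
      (hL.nonempty _ (mem_Lev_concat.2 ⟨⟨hi, hil⟩, ht⟩))) ?_
    rintro _ ⟨x, hx, y, hy, rfl⟩
    exact h2 i ⟨hi, hil⟩ hip s hs t ht hst x hx y hy
  · apply Subset.antisymm
    · intro x hx
      rw [mem_iInter]
      intro n
      have := hsub (n + 1) hx
      simp only [mem_iUnion] at this
      obtain ⟨l, hl, hxl⟩ := this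
      simp only [mem_iUnion]
      refine ⟨l.take (n + 1), ⟨hl.1.take _, ?_⟩, hpref _ _ hl.1 (take_isPre _ _) hxl⟩
      have := hl.2
      simp; omega
    · intro x hx
      rw [mem_iInter] at hx
      have hcl : x ∈ closure (K : Set X) := by
        rw [Metric.mem_closure_iff]
        intro ε hε
        obtain ⟨N, hN⟩ := exists_nat_one_div_lt hε
        have := hx (2 * N + 1)
        simp only [mem_iUnion] at this
        obtain ⟨l, hl, hxl⟩ := this
        obtain ⟨y, hyK, hyl⟩ := hmeet (N + 1) l hl
        refine ⟨y, hyK, ?_⟩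
        have hL := hlev (2 * N + 2) (by omega)
        refine lt_of_le_of_lt (hL.small l hl x hxl y hyl) (lt_of_le_of_lt hL.bsmall
          (lt_of_le_of_lt ?_ hN))
        apply one_div_le_one_div_of_le (by positivity)
        push_cast
        have : (0 : ℝ) ≤ N := Nat.cast_nonneg N
        linarith
      rwa [K.isCompact.isClosed.closure_eq] at hcl

/-! ### Stages of the construction -/

/-- A scheme: branching numbers, closed sets, and separation constants. -/
structure Scheme (X : Type*) where
  a : ℕ → ℕ
  C : List ℕ → Set X
  b : ℕ → ℝ

/-- The open set of compact sets compatible with a scheme up to level `2 * m`. -/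
def stageSet {X : Type*} [MetricSpace X] (m : ℕ) (σ : Scheme X) : Set (NonemptyCompacts X) :=
  {K | (∀ l ∈ Lev σ.a (2 * m), ∀ l' ∈ Lev σ.a (2 * m), l ≠ l' → Disjoint (σ.C l) (σ.C l')) ∧
    (K : Set X) ⊆ (⋃ l ∈ Lev σ.a (2 * m), interior (σ.C l)) ∧
    ∀ l ∈ Lev σ.a (2 * m), ((K : Set X) ∩ interior (σ.C l)).Nonempty}

/-- `τ` extends `σ` by two more levels. -/
structure StageRel {X : Type*} [MetricSpace X] (m : ℕ) (σ τ : Scheme X) : Prop where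
  agree_a : ∀ k < 2 * m, τ.a k = σ.a k
  agree_C : ∀ l : List ℕ, l.length ≤ 2 * m → τ.C l = σ.C l
  agree_b : ∀ n ≤ 2 * m, τ.b n = σ.b n
  grow1 : GrowOK τ.a (2 * m)
  grow2 : GrowOK τ.a (2 * m + 1)
  lev1 : LevelOK τ.a τ.C τ.b (2 * m + 1)
  lev2 : LevelOK τ.a τ.C τ.b (2 * m + 2)
  odd : OddOK τ.a τ.C m

lemma isOpen_stageSet {X : Type*} [MetricSpace X] (m : ℕ) (σ : Scheme X) :
    IsOpen (stageSet m σ) := by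
  have hfin : (Lev σ.a (2 * m)).Finite := validIdx_finite _ _
  refine IsOpen.and isOpen_const (IsOpen.and ?_ ?_)
  · exact NonemptyCompacts.isOpen_subsets_of_isOpen
      (isOpen_biUnion fun l _ => isOpen_interior)
  · have : {K : NonemptyCompacts X | ∀ l ∈ Lev σ.a (2 * m),
        ((K : Set X) ∩ interior (σ.C l)).Nonempty} =
        ⋂ l ∈ Lev σ.a (2 * m), {K : NonemptyCompacts X |
          ((K : Set X) ∩ interior (σ.C l)).Nonempty} := by
      ext K; simp
    rw [this]
    exact hfin.isOpen_biInter fun l _ =>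
      NonemptyCompacts.isOpen_inter_nonempty_of_isOpen isOpen_interior

/-- A branch of stages yields a balanced set. -/
lemma isBalanced_of_branch {X : Type*} [MetricSpace X] (K : NonemptyCompacts X)
    (s : ℕ → Scheme X) (hR : ∀ n, StageRel n (s n) (s (n + 1)))
    (hK : ∀ n, K ∈ stageSet n (s n)) : IsBalanced (K : Set X) := by
  have hagree : ∀ n d, (∀ k < 2 * n, (s (n + d)).a k = (s n).a k) ∧
      (∀ l : List ℕ, l.length ≤ 2 * n → (s (n + d)).C l = (s n).C l) ∧
      (∀ k ≤ 2 * n, (s (n + d)).b k = (s n).b k) := by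
    intro n d
    induction d with
    | zero => exact ⟨fun _ _ => rfl, fun _ _ => rfl, fun _ _ => rfl⟩
    | succ d ih =>
      have h := hR (n + d)
      refine ⟨fun k hk => ?_, fun l hl => ?_, fun k hk => ?_⟩
      · rw [← ih.1 k hk]; exact h.agree_a k (by omega)
      · rw [← ih.2.1 l hl]; exact h.agree_C l (by omega)
      · rw [← ih.2.2 k hk]; exact h.agree_b k (by omega)
  have hag : ∀ n n', n ≤ n' → (∀ k < 2 * n, (s n').a k = (s n).a k) ∧
      (∀ l : List ℕ, l.length ≤ 2 * n → (s n').C l = (s n).C l) ∧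
      (∀ k ≤ 2 * n, (s n').b k = (s n).b k) := by
    intro n n' h
    obtain ⟨d, rfl⟩ := Nat.exists_eq_add_of_le h
    exact hagree n d
  let a : ℕ → ℕ := fun k => (s (k + 1)).a k
  let C : List ℕ → Set X := fun l => (s l.length).C l
  let b : ℕ → ℝ := fun n => (s n).b n
  have ha : ∀ n, ∀ k < 2 * n, (s n).a k = a k := by
    intro n k hk
    rcases le_total n (k + 1) with h | h
    · exact ((hag _ _ h).1 k hk).symm
    · exact (hag _ _ h).1 k (by omega)
  have hC : ∀ n, ∀ l : List ℕ, l.length ≤ 2 * n → (s n).C l = C l := by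
    intro n l hl
    rcases le_total n l.length with h | h
    · exact ((hag _ _ h).2.1 l hl).symm
    · exact (hag _ _ h).2.1 l (by omega)
  have hb : ∀ n, ∀ k ≤ 2 * n, (s n).b k = b k := by
    intro n k hk
    rcases le_total n k with h | h
    · exact ((hag _ _ h).2.2 k hk).symm
    · exact (hag _ _ h).2.2 k (by omega)
  have hLev : ∀ n, Lev (s n).a (2 * n) = Lev a (2 * n) := fun n => Lev_congr (ha n)
  apply isBalanced_of_scheme K a C b
  · intro k
    obtain ⟨m, rfl | rfl⟩ := Nat.even_or_odd' k
    · exact (hR m).grow1.congr fun i hi => ha (m + 1) i (by omega)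
    · exact (hR m).grow2.congr fun i hi => ha (m + 1) i (by omega)
  · intro n hn
    obtain ⟨m, rfl | rfl⟩ := Nat.even_or_odd' n
    · obtain ⟨m, rfl⟩ : ∃ m', m = m' + 1 := ⟨m - 1, by omega⟩
      exact (hR m).lev2.congr (fun i hi => ha (m + 1) i (by omega))
        (fun l hl => hC (m + 1) l (by omega)) (hb (m + 1) _ (by omega))
    · exact (hR m).lev1.congr (fun i hi => ha (m + 1) i (by omega))
        (fun l hl => hC (m + 1) l (by omega)) (hb (m + 1) _ (by omega))
  · intro m
    exact (hR m).odd.congr (fun i hi => ha (m + 1) i (by omega))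
        (fun l hl => hC (m + 1) l (by omega))
  · intro n x hx
    have := (hK n).2.1 hx
    rw [hLev] at this
    simp only [mem_iUnion] at this ⊢
    obtain ⟨l, hl, hx⟩ := this
    exact ⟨l, hl, hC n l hl.2.le ▸ interior_subset hx⟩
  · intro n l hl
    have := (hK n).2.2 l (by rw [hLev]; exact hl)
    rw [hC n l hl.2.le] at this
    exact this.mono (inter_subset_inter_right _ interior_subset)

/-! ### Extension of a stage -/

lemma perfect_infinite {X : Type*} [MetricSpace X] (hperf : ∀ x : X, (nhdsWithin x {x}ᶜ).NeBot)
    {W : Set X} (hW : IsOpen W) (hne : W.Nonempty) : W.Infinite := by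
  obtain ⟨x, hx⟩ := hne
  have := hperf x
  exact infinite_of_mem_nhds x (hW.mem_nhds hx)

lemma exists_radius {X : Type*} [MetricSpace X] {T : Set (List ℕ)} (hT : T.Finite)
    (p : List ℕ → X) (hp : InjOn p T) (O : List ℕ → Set X) (hO : ∀ i ∈ T, O i ∈ nhds (p i))
    {η : ℝ} (hη : 0 < η) :
    ∃ r : ℝ, 0 < r ∧ r ≤ η ∧ (∀ i ∈ T, Metric.closedBall (p i) r ⊆ O i) ∧
      ∀ i ∈ T, ∀ j ∈ T, i ≠ j → 8 * r ≤ dist (p i) (p j) := by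
  have hlt : ∀ c : ℝ, 0 < c → ∀ᶠ r : ℝ in nhdsWithin 0 (Ioi 0), r ≤ c := fun c hc =>
    Filter.Eventually.filter_mono nhdsWithin_le_nhds
      ((eventually_lt_nhds hc).mono fun _ h => h.le)
  have h1 : ∀ᶠ r : ℝ in nhdsWithin 0 (Ioi 0), ∀ i ∈ T, Metric.closedBall (p i) r ⊆ O i := by
    rw [hT.eventually_all]
    intro i hi
    obtain ⟨e, he, hsub⟩ := Metric.nhds_basis_closedBall.mem_iff.1 (hO i hi)
    exact (hlt e he).mono fun r hr => (Metric.closedBall_subset_closedBall hr).trans hsub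
  have h2 : ∀ᶠ r : ℝ in nhdsWithin 0 (Ioi 0), ∀ i ∈ T, ∀ j ∈ T, i ≠ j →
      8 * r ≤ dist (p i) (p j) := by
    rw [hT.eventually_all]
    intro i hi
    rw [hT.eventually_all]
    intro j hj
    by_cases hij : i = j
    · exact Filter.Eventually.of_forall fun r h => absurd hij h
    · have hd : 0 < dist (p i) (p j) := dist_pos.2 fun h => hij (hp hi hj h)
      refine (hlt (dist (p i) (p j) / 8) (by positivity)).mono fun r hr _ => by linarith
  have h3 : ∀ᶠ r : ℝ in nhdsWithin 0 (Ioi 0), 0 < r := eventually_mem_nhdsWithin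
  obtain ⟨r, ha, hb, hc, hd⟩ := (h3.and ((hlt η hη).and (h1.and h2))).exists
  exact ⟨r, ha, hb, hc, hd⟩

lemma exists_points {X : Type*} [MetricSpace X] (hperf : ∀ x : X, (nhdsWithin x {x}ᶜ).NeBot)
    (K : NonemptyCompacts X) {T : Set (List ℕ)} (hT : T.Finite) (O : List ℕ → Set X)
    (hO : ∀ l ∈ T, IsOpen (O l))
    (hdisj : ∀ l ∈ T, ∀ l' ∈ T, l ≠ l' → Disjoint (O l) (O l'))
    (hsub : (K : Set X) ⊆ ⋃ l ∈ T, O l) (hmeet : ∀ l ∈ T, ((K : Set X) ∩ O l).Nonempty)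
    (M : ℕ) {ε : ℝ} (hε : 0 < ε) :
    ∃ A : ℕ, M ≤ A ∧ ∃ p : List ℕ → X,
      (∀ l ∈ T, ∀ s < A, ∀ l' ∈ T, ∀ s' < A, p (l ++ [s]) = p (l' ++ [s']) → l = l' ∧ s = s') ∧
      (∀ l ∈ T, ∀ s < A, p (l ++ [s]) ∈ O l ∧ ∃ y ∈ (K : Set X), dist (p (l ++ [s])) y < ε) ∧
      ∀ y ∈ (K : Set X), ∃ l ∈ T, ∃ s < A, dist y (p (l ++ [s])) < ε := by
  obtain ⟨N, hNK, hNfin, hNcov⟩ := K.isCompact.finite_cover_balls hε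
  lift N to Finset X using hNfin
  let W : List ℕ → Set X := fun l => O l ∩ Metric.thickening ε (K : Set X)
  have hWo : ∀ l ∈ T, IsOpen (W l) := fun l hl => (hO l hl).inter Metric.isOpen_thickening
  have hWne : ∀ l ∈ T, (W l).Nonempty := by
    intro l hl
    obtain ⟨x, hxK, hxO⟩ := hmeet l hl
    exact ⟨x, hxO, Metric.self_subset_thickening hε _ hxK⟩
  set A := max M N.card with hA
  have hex : ∀ l : List ℕ, ∃ f : ℕ → X, l ∈ T → (InjOn f (Iio A) ∧ (∀ s < A, f s ∈ W l) ∧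
      ∀ x ∈ N, x ∈ O l → ∃ s < A, f s = x) := by
    intro l
    by_cases hl : l ∈ T
    swap
    · exact ⟨fun _ => K.nonempty.some, fun h => absurd h hl⟩
    have : Infinite (W l) := (perfect_infinite hperf (hWo l hl) (hWne l hl)).to_subtype
    let Nl : Finset (W l) := N.subtype (fun x => x ∈ W l)
    have hc : Nl.card ≤ A := by
      refine le_trans ?_ (le_max_right _ _)
      rw [Finset.card_subtype]
      exact Finset.card_filter_le _ _
    obtain ⟨F, hNF, hFc⟩ := Infinite.exists_superset_card_eq Nl A hc
    let e := F.equivFinOfCardEq hFc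
    refine ⟨fun s => if h : s < A then ((e.symm ⟨s, h⟩ : F) : W l) else K.nonempty.some,
      fun _ => ⟨?_, ?_, ?_⟩⟩
    · intro s hs t ht hst
      simp only [mem_Iio] at hs ht
      simp only [hs, ht, dif_pos] at hst
      have := e.symm.injective (Subtype.ext (Subtype.ext hst))
      simpa using this
    · intro s hs
      simp only [hs, dif_pos]
      exact ((e.symm ⟨s, hs⟩ : F) : W l).2
    · intro x hxN hxO
      have hxW : x ∈ W l := ⟨hxO, Metric.self_subset_thickening hε _ (hNK hxN)⟩
      have hxF : (⟨x, hxW⟩ : W l) ∈ F := hNF (by simpa [Nl] using hxN)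
      refine ⟨e ⟨_, hxF⟩, (e ⟨_, hxF⟩).2, ?_⟩
      simp
  choose f hf using hex
  refine ⟨A, le_max_left _ _, fun i => f i.dropLast (i.getLastD 0), ?_, ?_, ?_⟩
  · intro l hl s hs l' hl' s' hs' heq
    simp only [List.dropLast_concat, List.getLastD_concat] at heq
    have h1 := ((hf l hl).2.1 s hs).1
    have h2 := ((hf l' hl').2.1 s' hs').1
    have hll : l = l' := by
      by_contra hne
      rw [heq] at h1
      exact Set.disjoint_left.1 (hdisj l hl l' hl' hne) h1 h2
    subst hll
    exact ⟨rfl, (hf l hl).1 hs hs' heq⟩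
  · intro l hl s hs
    simp only [List.dropLast_concat, List.getLastD_concat]
    obtain ⟨h1, h2⟩ := (hf l hl).2.1 s hs
    exact ⟨h1, Metric.mem_thickening_iff.1 h2⟩
  · intro y hy
    have := hNcov hy
    simp only [mem_iUnion] at this
    obtain ⟨x, hxN, hyx⟩ := this
    have := hsub (hNK hxN)
    simp only [mem_iUnion] at this
    obtain ⟨l, hl, hxl⟩ := this
    obtain ⟨s, hs, hfs⟩ := (hf l hl).2.2 x hxN hxl
    refine ⟨l, hl, s, hs, ?_⟩
    simp only [List.dropLast_concat, List.getLastD_concat, hfs]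
    exact hyx

lemma exists_subpoints {X : Type*} [MetricSpace X]
    (hperf : ∀ x : X, (nhdsWithin x {x}ᶜ).NeBot) {T : Set (List ℕ)} (hT : T.Finite)
    (p : List ℕ → X) {r : ℝ} (hr : 0 < r) (S : List ℕ → Prop) (B : ℕ) :
    ∃ q : List ℕ → X, ∃ D : ℝ, 0 < D ∧
      (∀ i u, q (i ++ [u]) ∈ Metric.ball (p i) r) ∧
      (∀ i u v, u ≠ v → q (i ++ [u]) ≠ q (i ++ [v])) ∧
      (∀ i ∈ T, S i → ∀ u < B, ∀ v < B, u ≠ v → 16 * D ≤ dist (q (i ++ [u])) (q (i ++ [v]))) ∧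
      (∀ i u, ¬ S i → q (i ++ [u]) ∈ Metric.ball (p i) D) := by
  have hseq : ∀ (e : ℝ), 0 < e → ∀ i : List ℕ, ∃ f : ℕ → X, Function.Injective f ∧
      ∀ u, f u ∈ Metric.ball (p i) e := by
    intro e he i
    have hinf := perfect_infinite hperf (Metric.isOpen_ball (x := p i) (ε := e))
      ⟨p i, Metric.mem_ball_self he⟩
    exact ⟨fun u => hinf.natEmbedding _ u,
      fun u v h => (hinf.natEmbedding _).injective (Subtype.ext h), fun u => (hinf.natEmbedding _ u).2⟩
  choose f hfi hfm using hseq r hr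
  have hlt : ∀ c : ℝ, 0 < c → ∀ᶠ r : ℝ in nhdsWithin 0 (Ioi 0), r ≤ c := fun c hc =>
    Filter.Eventually.filter_mono nhdsWithin_le_nhds
      ((eventually_lt_nhds hc).mono fun _ h => h.le)
  have h1 : ∀ᶠ D : ℝ in nhdsWithin 0 (Ioi 0), ∀ i ∈ T, ∀ u ∈ Iio B, ∀ v ∈ Iio B, u ≠ v →
      16 * D ≤ dist (f i u) (f i v) := by
    rw [hT.eventually_all]
    intro i hi
    rw [(finite_Iio B).eventually_all]
    intro u hu
    rw [(finite_Iio B).eventually_all]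
    intro v hv
    by_cases huv : u = v
    · exact Filter.Eventually.of_forall fun r h => absurd huv h
    · have hd : 0 < dist (f i u) (f i v) := dist_pos.2 fun h => huv (hfi i h)
      refine (hlt (dist (f i u) (f i v) / 16) (by positivity)).mono fun r hr _ => by linarith
  have h3 : ∀ᶠ r : ℝ in nhdsWithin 0 (Ioi 0), 0 < r := eventually_mem_nhdsWithin
  obtain ⟨D, hD, hDf⟩ := (h3.and h1).exists
  choose g hgi hgm using hseq (min r D) (lt_min hr hD)
  refine ⟨fun l => if S l.dropLast then f l.dropLast (l.getLastD 0)
    else g l.dropLast (l.getLastD 0), D, hD, ?_, ?_, ?_, ?_⟩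
  · intro i u
    simp only [List.dropLast_concat, List.getLastD_concat]
    split_ifs
    · exact hfm i u
    · exact Metric.ball_subset_ball (min_le_left _ _) (hgm i u)
  · intro i u v huv
    simp only [List.dropLast_concat, List.getLastD_concat]
    split_ifs
    · exact fun h => huv (hfi i h)
    · exact fun h => huv (hgi i h)
  · intro i hi hS u hu v hv huv
    simp only [List.dropLast_concat, List.getLastD_concat, if_pos hS]
    exact hDf i hi u hu v hv huv
  · intro i u hS
    simp only [List.dropLast_concat, List.getLastD_concat, if_neg hS]
    exact Metric.ball_subset_ball (min_le_right _ _) (hgm i u)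

/-- Building a level out of small closed balls. -/
lemma levelOK_of_balls {X : Type*} [MetricSpace X] {a : ℕ → ℕ} {C : List ℕ → Set X} {b : ℕ → ℝ}
    {n : ℕ} {p : List ℕ → X} {r : ℝ} (hr : 0 < r) (hb : b n = 2 * r)
    (hr' : r ≤ 1 / (2 * ((n : ℝ) + 1)))
    (hC : ∀ l ∈ Lev a n, C l = Metric.closedBall (p l) r)
    (hnest : ∀ l x, l ++ [x] ∈ Lev a n → C (l ++ [x]) ⊆ C l)
    (hsep : ∀ i ∈ Lev a n, ∀ j ∈ Lev a n, i ≠ j → 8 * r ≤ dist (p i) (p j)) :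
    LevelOK a C b n := by
  constructor
  · rw [hb]; linarith
  · rw [hb]
    have : 1 / ((n : ℝ) + 1) = 2 * (1 / (2 * ((n : ℝ) + 1))) := by field_simp
    rw [this]; linarith
  · exact hnest
  · intro l hl
    rw [hC l hl]; exact ⟨p l, Metric.mem_closedBall_self hr.le⟩
  · intro l hl
    rw [hC l hl]; exact Metric.isClosed_closedBall
  · intro l hl x hx y hy
    rw [hC l hl] at hx hy
    rw [hb]
    have h1 := Metric.mem_closedBall.1 hx
    have h2 := Metric.mem_closedBall'.1 hy
    linarith [dist_triangle x (p l) y]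
  · intro l hl l' hl' hne x hx y hy
    rw [hC l hl] at hx
    rw [hC l' hl'] at hy
    rw [hb]
    have h1 := Metric.mem_closedBall'.1 hx
    have h2 := Metric.mem_closedBall.1 hy
    have h3 := hsep l hl l' hl' hne
    linarith [dist_triangle4 (p l) x y (p l')]

lemma stage_dense {X : Type*} [MetricSpace X] (hperf : ∀ x : X, (nhdsWithin x {x}ᶜ).NeBot)
    (m : ℕ) (σ : Scheme X) :
    stageSet m σ ⊆ closure (⋃ τ ∈ {τ | StageRel m σ τ}, stageSet (m + 1) τ) := by
  rintro K ⟨hdisj, hsub, hmeet⟩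
  rw [Metric.mem_closure_iff]
  intro ε hε
  set T := Lev σ.a (2 * m) with hTdef
  have hTfin : T.Finite := validIdx_finite _ _
  obtain ⟨A, hAM, p, hpinj, hpO, hpcov⟩ := exists_points hperf K hTfin
    (fun l => interior (σ.C l)) (fun _ _ => isOpen_interior)
    (fun l hl l' hl' hne => (hdisj l hl l' hl' hne).mono interior_subset interior_subset)
    hsub hmeet (max 2 (2 * m * ∏ i ∈ Finset.range (2 * m), σ.a i))
    (ε := ε / 4) (by positivity)
  -- the new branching numbers
  let a1 : ℕ → ℕ := fun k => if k = 2 * m then A else σ.a k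
  let B : ℕ := max 2 ((2 * m + 1) * ∏ i ∈ Finset.range (2 * m + 1), a1 i)
  let a2 : ℕ → ℕ := fun k => if k = 2 * m + 1 then B else a1 k
  have ha20 : ∀ k < 2 * m, a2 k = σ.a k := by
    intro k hk
    simp only [a2, a1]
    rw [if_neg (by omega), if_neg (by omega)]
  have ha21 : a2 (2 * m) = A := by simp [a2, a1]
  have ha22 : a2 (2 * m + 1) = B := by simp [a2]
  have ha12 : ∀ k < 2 * m + 1, a1 k = a2 k := by
    intro k hk
    simp only [a2]
    rw [if_neg (by omega)]
  have hLev0 : Lev a2 (2 * m) = T := Lev_congr ha20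
  set T1 := Lev a2 (2 * m + 1) with hT1
  set T2 := Lev a2 (2 * m + 2) with hT2
  have hT1fin : T1.Finite := validIdx_finite _ _
  have hT2fin : T2.Finite := validIdx_finite _ _
  have hmem1 : ∀ l x, l ++ [x] ∈ T1 ↔ l ∈ T ∧ x < A := by
    intro l x
    rw [hT1, mem_Lev_concat, hLev0, ha21]
  have hcase1 : ∀ i ∈ T1, ∃ l x, i = l ++ [x] ∧ l ∈ T ∧ x < A := by
    intro i hi
    obtain ⟨l, x, h1, h2, h3⟩ := Lev_succ_cases hi
    rw [hLev0] at h2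
    rw [ha21] at h3
    exact ⟨l, x, h1, h2, h3⟩
  have hmem2 : ∀ l x, l ++ [x] ∈ T2 ↔ l ∈ T1 ∧ x < B := by
    intro l x
    rw [hT2, mem_Lev_concat, ha22]
  have hcase2 : ∀ i ∈ T2, ∃ l x, i = l ++ [x] ∧ l ∈ T1 ∧ x < B := by
    intro i hi
    obtain ⟨l, x, h1, h2, h3⟩ := Lev_succ_cases hi
    rw [ha22] at h3
    exact ⟨l, x, h1, h2, h3⟩
  -- first radius
  have hpI : InjOn p T1 := by
    intro i hi j hj hij
    obtain ⟨l, x, rfl, hl, hx⟩ := hcase1 i hi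
    obtain ⟨l', x', rfl, hl', hx'⟩ := hcase1 j hj
    obtain ⟨rfl, rfl⟩ := hpinj l hl x hx l' hl' x' hx' hij
    rfl
  obtain ⟨r1, hr1, hr1le, hr1O, hr1sep⟩ := exists_radius hT1fin p hpI
    (fun i => interior (σ.C i.dropLast)) (by
      intro i hi
      obtain ⟨l, x, rfl, hl, hx⟩ := hcase1 i hi
      simp only [List.dropLast_concat]
      exact isOpen_interior.mem_nhds (hpO l hl x hx).1)
    (η := min (ε / 4) (1 / (2 * (((2 * m + 1 : ℕ) : ℝ) + 1)))) (by positivity)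
  -- second level of points
  obtain ⟨q, D, hD, hqball, hqne, hqsep, hqsmall⟩ := exists_subpoints hperf hT1fin p hr1
    (fun i => phiIdx a2 m <+: i) B
  have hqI : InjOn q T2 := by
    intro i hi j hj hij
    obtain ⟨l, x, rfl, hl, hx⟩ := hcase2 i hi
    obtain ⟨l', x', rfl, hl', hx'⟩ := hcase2 j hj
    have hll : l = l' := by
      by_contra hne
      have h1 := Metric.mem_ball'.1 (hqball l x)
      have h2 := Metric.mem_ball.1 (hqball l' x')
      rw [hij] at h1
      linarith [dist_triangle (p l) (q (l' ++ [x'])) (p l'), hr1sep l hl l' hl' hne]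
    subst hll
    have hxx : x = x' := by
      by_contra hne
      exact hqne l x x' hne hij
    rw [hxx]
  obtain ⟨r2, hr2, hr2le, hr2O, hr2sep⟩ := exists_radius hT2fin q hqI
    (fun i => Metric.ball (p i.dropLast) r1) (by
      intro i hi
      obtain ⟨l, x, rfl, hl, hx⟩ := hcase2 i hi
      simp only [List.dropLast_concat]
      exact Metric.isOpen_ball.mem_nhds (hqball l x))
    (η := min D (1 / (2 * (((2 * m + 2 : ℕ) : ℝ) + 1)))) (by positivity)
  -- the new scheme
  let C2 : List ℕ → Set X := fun l => if l.length = 2 * m + 1 then Metric.closedBall (p l) r1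
    else if l.length = 2 * m + 2 then Metric.closedBall (q l) r2 else σ.C l
  let b2 : ℕ → ℝ := fun n => if n = 2 * m + 1 then 2 * r1
    else if n = 2 * m + 2 then 2 * r2 else σ.b n
  have hC0 : ∀ l : List ℕ, l.length ≤ 2 * m → C2 l = σ.C l := by
    intro l hl
    simp only [C2]
    rw [if_neg (by omega), if_neg (by omega)]
  have hC1 : ∀ l ∈ T1, C2 l = Metric.closedBall (p l) r1 := by
    intro l hl
    simp only [C2]
    rw [if_pos hl.2]
  have hC2 : ∀ l ∈ T2, C2 l = Metric.closedBall (q l) r2 := by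
    intro l hl
    have := hl.2
    simp only [C2]
    rw [if_neg (by omega), if_pos this]
  have hlev1 : LevelOK a2 C2 b2 (2 * m + 1) := by
    refine levelOK_of_balls hr1 (by simp [b2]) (hr1le.trans (min_le_right _ _)) hC1 ?_ hr1sep
    intro l x hl
    rw [hC1 _ hl, hC0 l ((hmem1 l x).1 hl).1.2.le]
    have := hr1O _ hl
    simp only [List.dropLast_concat] at this
    exact this.trans interior_subset
  have hlev2 : LevelOK a2 C2 b2 (2 * m + 2) := by
    refine levelOK_of_balls hr2 (by simp [b2]) (hr2le.trans (min_le_right _ _)) hC2 ?_ hr2sep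
    intro l x hl
    rw [hC2 _ hl, hC1 l ((hmem2 l x).1 hl).1]
    have := hr2O _ hl
    simp only [List.dropLast_concat] at this
    exact this.trans Metric.ball_subset_closedBall
  have hr2D : r2 ≤ D := hr2le.trans (min_le_left _ _)
  have hodd : OddOK a2 C2 m := by
    refine ⟨4 * D, by positivity, ?_, ?_⟩
    · intro j hj hn u hu v hv x hx y hy
      rw [ha22] at hu hv
      rw [hC2 _ ((hmem2 j u).2 ⟨hj, hu⟩)] at hx
      rw [hC2 _ ((hmem2 j v).2 ⟨hj, hv⟩)] at hy
      have h1 := Metric.mem_closedBall.1 hx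
      have h2 := Metric.mem_closedBall'.1 hy
      have h3 := Metric.mem_ball.1 (hqsmall j u hn)
      have h4 := Metric.mem_ball'.1 (hqsmall j v hn)
      linarith [dist_triangle4 x (q (j ++ [u])) (q (j ++ [v])) y,
        dist_triangle (q (j ++ [u])) (p j) (q (j ++ [v]))]
    · intro i hi hn u hu v hv huv x hx y hy
      rw [ha22] at hu hv
      rw [hC2 _ ((hmem2 i u).2 ⟨hi, hu⟩)] at hx
      rw [hC2 _ ((hmem2 i v).2 ⟨hi, hv⟩)] at hy
      have h1 := Metric.mem_closedBall'.1 hx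
      have h2 := Metric.mem_closedBall.1 hy
      have h3 := hqsep i hi hn u hu v hv huv
      linarith [dist_triangle4 (q (i ++ [u])) x y (q (i ++ [v]))]
  have hrel : StageRel m σ ⟨a2, C2, b2⟩ := by
    refine ⟨ha20, hC0, ?_, ?_, ?_, hlev1, hlev2, hodd⟩
    · intro n hn
      simp only [b2]
      rw [if_neg (by omega), if_neg (by omega)]
    · refine ⟨?_, ?_⟩
      · change 2 ≤ a2 (2 * m)
        rw [ha21]; exact (le_max_left _ _).trans hAM
      · change 2 * m * ∏ i ∈ Finset.range (2 * m), a2 i ≤ a2 (2 * m)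
        rw [ha21, Finset.prod_congr rfl fun i hi => ha20 i (Finset.mem_range.1 hi)]
        exact (le_max_right _ _).trans hAM
    · refine ⟨?_, ?_⟩
      · change 2 ≤ a2 (2 * m + 1)
        rw [ha22]; exact le_max_left _ _
      · change (2 * m + 1) * ∏ i ∈ Finset.range (2 * m + 1), a2 i ≤ a2 (2 * m + 1)
        rw [ha22, ← Finset.prod_congr rfl fun i hi => ha12 i (Finset.mem_range.1 hi)]
        exact le_max_right _ _
  have hB0 : 0 < B := lt_of_lt_of_le (by norm_num) (le_max_left _ _)
  -- the approximating finite set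
  have hcovq : ∀ y ∈ (K : Set X), ∃ z ∈ q '' T2, dist y z ≤ ε / 2 := by
    intro y hy
    obtain ⟨l, hl, s, hs, hd⟩ := hpcov y hy
    have h1 : l ++ [s] ∈ T1 := (hmem1 l s).2 ⟨hl, hs⟩
    refine ⟨q ((l ++ [s]) ++ [0]), ⟨_, (hmem2 _ 0).2 ⟨h1, hB0⟩, rfl⟩, ?_⟩
    have h2 := Metric.mem_ball'.1 (hqball (l ++ [s]) 0)
    have h3 := hr1le.trans (min_le_left _ _)
    linarith [dist_triangle y (p (l ++ [s])) (q ((l ++ [s]) ++ [0]))]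
  have hqK : ∀ z ∈ q '' T2, ∃ y ∈ (K : Set X), dist z y ≤ ε / 2 := by
    rintro _ ⟨i, hi, rfl⟩
    obtain ⟨i', u, rfl, hi', hu⟩ := hcase2 i hi
    obtain ⟨l, s, rfl, hl, hs⟩ := hcase1 i' hi'
    obtain ⟨-, y, hy, hd⟩ := hpO l hl s hs
    refine ⟨y, hy, ?_⟩
    have h2 := Metric.mem_ball.1 (hqball (l ++ [s]) u)
    have h3 := hr1le.trans (min_le_left _ _)
    linarith [dist_triangle (q ((l ++ [s]) ++ [u])) (p (l ++ [s])) y]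
  have hne : (q '' T2).Nonempty := by
    obtain ⟨y, hy⟩ := K.nonempty
    obtain ⟨z, hz, -⟩ := hcovq y hy
    exact ⟨z, hz⟩
  let K' : NonemptyCompacts X := ⟨⟨q '' T2, (hT2fin.image q).isCompact⟩, hne⟩
  have hqint : ∀ i ∈ T2, q i ∈ interior (C2 i) := by
    intro i hi
    rw [hC2 i hi]
    exact Metric.ball_subset_interior_closedBall (Metric.mem_ball_self hr2)
  refine ⟨K', ?_, ?_⟩
  · refine mem_biUnion (show StageRel m σ ⟨a2, C2, b2⟩ from hrel) ⟨?_, ?_, ?_⟩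
    · intro l hl l' hl' hne
      rw [Set.disjoint_left]
      intro x hx hx'
      have := hlev2.sep l hl l' hl' hne x hx x hx'
      rw [dist_self] at this
      linarith [hlev2.bpos]
    · rintro _ ⟨i, hi, rfl⟩
      exact mem_biUnion (show i ∈ Lev a2 (2 * (m + 1)) from hi) (hqint i hi)
    · intro i hi
      exact ⟨q i, ⟨i, hi, rfl⟩, hqint i hi⟩
  · rw [Metric.NonemptyCompacts.dist_eq]
    refine lt_of_le_of_lt (Metric.hausdorffDist_le_of_mem_dist (r := ε / 2) (by positivity)
      hcovq hqK) (by linarith)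

/-- In a non-empty perfect Polish space, the balanced compact sets form a comeager subset
of the hyperspace `K(X)` of non-empty compact sets with the Hausdorff metric. -/
theorem balanced_compacts_comeager
    {X : Type*} [MetricSpace X] [Nonempty X] [CompleteSpace X] [SeparableSpace X]
    (hperf : ∀ x : X, (nhdsWithin x {x}ᶜ).NeBot) :
    {K : NonemptyCompacts X | IsBalanced (K : Set X)} ∈ residual (NonemptyCompacts X) := by
  have : SecondCountableTopology X := UniformSpace.secondCountable_of_separable X
  let s0 : Scheme X := ⟨fun _ => 0, fun _ => univ, fun _ => 0⟩
  have h0 : stageSet 0 s0 = univ := by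
    rw [eq_univ_iff_forall]
    intro K
    have hnil : ∀ l, l ∈ Lev s0.a (2 * 0) ↔ l = [] := by
      intro l
      constructor
      · intro h
        simpa using h.2
      · rintro rfl
        exact ⟨fun k hk => by simp at hk, rfl⟩
    refine ⟨?_, ?_, ?_⟩
    · intro l hl l' hl' hne
      rw [hnil] at hl hl'
      exact absurd (hl.trans hl'.symm) hne
    · intro x _
      simp only [mem_iUnion]
      exact ⟨[], (hnil _).2 rfl, by simp [s0]⟩
    · intro l _
      simpa [s0] using K.nonempty
  have := generic_branch stageSet StageRel s0 isOpen_stageSet h0 (stage_dense hperf)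
  filter_upwards [this] with K hK
  obtain ⟨s, -, hR, hKs⟩ := hK
  exact isBalanced_of_branch K s hR hKs
end

section
/- Let X be a Polish space. Then for a generic non-empty compact set K ⊆ X, K can be written as the union of a balanced compact set (or the empty set) and a finite set. -/
open Filter Set TopologicalSpace
open scoped Classical

namespace BalGen

/-- All one-step extensions of the lists in `L` by an entry `< α`. -/
noncomputable def ch (L : Finset (List ℕ)) (α : ℕ) : Finset (List ℕ) :=
  (L ×ˢ Finset.range α).image (fun p => p.1 ++ [p.2])

theorem mem_ch {L : Finset (List ℕ)} {α : ℕ} {l : List ℕ} :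
    l ∈ ch L α ↔ ∃ q ∈ L, ∃ u < α, l = q ++ [u] := by
  unfold ch
  simp only [Finset.mem_image, Finset.mem_product, Finset.mem_range, Prod.exists]
  constructor
  · rintro ⟨q, u, ⟨h1, h2⟩, rfl⟩
    exact ⟨q, h1, u, h2, rfl⟩
  · rintro ⟨q, h1, u, h2, rfl⟩
    exact ⟨q, u, ⟨h1, h2⟩, rfl⟩

theorem append_mem_ch {L : Finset (List ℕ)} {α : ℕ} {q : List ℕ} {u : ℕ} :
    q ++ [u] ∈ ch L α ↔ q ∈ L ∧ u < α := by
  rw [mem_ch]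
  constructor
  · rintro ⟨q', h1, u', h2, h⟩
    have := List.append_inj' h rfl
    simp at this
    obtain ⟨rfl, rfl⟩ := this
    exact ⟨h1, h2⟩
  · rintro ⟨h1, h2⟩
    exact ⟨q, h1, u, h2, rfl⟩

theorem card_ch (L : Finset (List ℕ)) (α : ℕ) : (ch L α).card = L.card * α := by
  unfold ch
  rw [Finset.card_image_of_injective, Finset.card_product, Finset.card_range]
  rintro ⟨a, b⟩ ⟨c, d⟩ h
  have := List.append_inj' h rfl
  simp at this
  simp [this]

theorem valid_append {a : ℕ → ℕ} {l : List ℕ} {x : ℕ} :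
    ValidIdx a (l ++ [x]) ↔ ValidIdx a l ∧ x < a l.length := by
  unfold ValidIdx
  constructor
  · intro h
    refine ⟨fun k hk => ?_, ?_⟩
    · have := h k (by simp; omega)
      simpa [List.getElem_append_left hk] using this
    · have := h l.length (by simp)
      simpa using this
  · rintro ⟨h1, h2⟩ k hk
    simp at hk
    by_cases hkl : k < l.length
    · simpa [List.getElem_append_left hkl] using h1 k hkl
    · have : k = l.length := by omega
      subst this
      simpa using h2

theorem valid_nil {a : ℕ → ℕ} : ValidIdx a [] := by
  intro k hk
  simp at hk

theorem valid_prefix {a : ℕ → ℕ} {p l : List ℕ} (h : p <+: l) (hl : ValidIdx a l) :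
    ValidIdx a p := by
  obtain ⟨t, rfl⟩ := h
  induction t using List.reverseRecOn with
  | nil => simpa using hl
  | append_singleton t x ih =>
    apply ih
    rw [← List.append_assoc, valid_append] at hl
    exact hl.1

theorem valid_extend {a : ℕ → ℕ} (ha : ∀ k, 1 ≤ a k) {p : List ℕ} (hp : ValidIdx a p) (n : ℕ) :
    ValidIdx a (p ++ List.replicate n 0) := by
  induction n with
  | zero => simpa using hp
  | succ n ih =>
    rw [List.replicate_succ', ← List.append_assoc, valid_append]
    exact ⟨ih, ha _⟩

/-- Valid tuples of length `n`. -/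
noncomputable def VL (a : ℕ → ℕ) : ℕ → Finset (List ℕ)
  | 0 => {[]}
  | n + 1 => ch (VL a n) (a n)

theorem mem_VL {a : ℕ → ℕ} {n : ℕ} {l : List ℕ} :
    l ∈ VL a n ↔ ValidIdx a l ∧ l.length = n := by
  induction n generalizing l with
  | zero =>
    simp only [VL, Finset.mem_singleton, List.length_eq_zero_iff]
    constructor
    · rintro rfl
      exact ⟨valid_nil, rfl⟩
    · exact fun h => h.2
  | succ n ih =>
    rcases List.eq_nil_or_concat l with rfl | ⟨q, u, rfl⟩
    · simp [VL, mem_ch]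
    · simp only [VL, append_mem_ch, ih, valid_append, List.length_append, List.length_singleton,
        List.concat_eq_append]
      constructor
      · rintro ⟨⟨h1, rfl⟩, h2⟩
        exact ⟨⟨h1, h2⟩, rfl⟩
      · rintro ⟨⟨h1, h2⟩, h3⟩
        have h3 : q.length = n := by omega
        subst h3
        exact ⟨⟨h1, rfl⟩, h2⟩

theorem card_VL (a : ℕ → ℕ) (n : ℕ) : (VL a n).card = ∏ i ∈ Finset.range n, a i := by
  induction n with
  | zero => simp [VL]
  | succ n ih => simp [VL, card_ch, ih, Finset.prod_range_succ]

theorem le_setDist {X : Type*} [MetricSpace X] {A B : Set X} {c : ℝ} (hA : A.Nonempty)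
    (hB : B.Nonempty) (h : ∀ x ∈ A, ∀ y ∈ B, c ≤ dist x y) : c ≤ SetDist A B := by
  unfold SetDist
  apply le_csInf (hA.image2 hB)
  rintro _ ⟨x, hx, y, hy, rfl⟩
  exact h x hx y hy

theorem disj_of_setDist {X : Type*} [MetricSpace X] {A B : Set X} (h : 0 < SetDist A B) :
    ∀ x ∈ A, x ∉ B := by
  intro x hA hB
  have : SetDist A B ≤ dist x x := by
    unfold SetDist
    apply csInf_le
    · refine ⟨0, ?_⟩
      rintro _ ⟨x, hx, y, hy, rfl⟩
      exact dist_nonneg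
    · exact ⟨x, hA, x, hB, rfl⟩
  simp at this
  linarith

theorem exists_injOn {ι X : Type*} [Nonempty X] (S : Finset ι) (V : ι → Set X)
    (hV : ∀ i ∈ S, (V i).Infinite) :
    ∃ y : ι → X, (∀ i ∈ S, y i ∈ V i) ∧ ∀ i ∈ S, ∀ j ∈ S, i ≠ j → y i ≠ y j := by
  induction S using Finset.induction_on with
  | empty => exact ⟨fun _ => Classical.arbitrary X, by simp, by simp⟩
  | insert i S hi ih =>
    obtain ⟨y, h1, h2⟩ := ih (fun j hj => hV j (Finset.mem_insert_of_mem hj))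
    obtain ⟨x, hx, hx'⟩ := (hV i (Finset.mem_insert_self _ _)).exists_notMem_finset (S.image y)
    have hx2 : ∀ j ∈ S, y j ≠ x := fun j hj h => hx' (Finset.mem_image.2 ⟨j, hj, h⟩)
    refine ⟨Function.update y i x, ?_, ?_⟩
    · intro j hj
      by_cases hji : j = i
      · subst hji; simpa using hx
      · simpa [hji] using h1 j (by simpa [hji] using hj)
    · intro j hj k hk hjk
      by_cases hji : j = i
      · by_cases hki : k = i
        · exact absurd (hji.trans hki.symm) hjk
        · subst hji
          simpa [hki] using (hx2 k (by simpa [hki] using hk)).symm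
      · by_cases hki : k = i
        · subst hki
          simpa [hji] using (hx2 j (by simpa [hji] using hj))
        · simpa [hji, hki] using h2 j (by simpa [hji] using hj) k (by simpa [hki] using hk) hjk

theorem exists_pos_le {ι : Type*} (S : Finset ι) (g : ι → ℝ) (hg : ∀ i ∈ S, 0 < g i) :
    ∃ c > 0, ∀ i ∈ S, c ≤ g i := by
  induction S using Finset.induction_on with
  | empty => exact ⟨1, one_pos, by simp⟩
  | insert i S hi ih =>
    obtain ⟨c, hc, h⟩ := ih (fun j hj => hg j (Finset.mem_insert_of_mem hj))
    refine ⟨min c (g i), lt_min hc (hg i (Finset.mem_insert_self _ _)), ?_⟩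
    intro j hj
    rcases Finset.mem_insert.1 hj with rfl | hj
    · exact min_le_right _ _
    · exact (min_le_left _ _).trans (h j hj)

/-- Points in infinite open sets, uniformly separated, with uniform balls inside. -/
theorem exists_sep {ι X : Type*} [MetricSpace X] [Nonempty X] (S : Finset ι) (V : ι → Set X)
    (hV : ∀ i ∈ S, (V i).Infinite) (hVo : ∀ i ∈ S, IsOpen (V i)) :
    ∃ y : ι → X, ∃ c > 0, (∀ i ∈ S, y i ∈ V i) ∧ (∀ i ∈ S, Metric.ball (y i) c ⊆ V i) ∧
      ∀ i ∈ S, ∀ j ∈ S, i ≠ j → c ≤ dist (y i) (y j) := by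
  obtain ⟨y, h1, h2⟩ := exists_injOn S V hV
  obtain ⟨c, hc, h3⟩ := exists_pos_le S.offDiag (fun p => dist (y p.1) (y p.2)) (by
    rintro ⟨i, j⟩ h
    rw [Finset.mem_offDiag] at h
    exact dist_pos.2 (h2 i h.1 j h.2.1 h.2.2))
  have h4 : ∀ i : ι, ∃ r > 0, i ∈ S → Metric.ball (y i) r ⊆ V i := by
    intro i
    by_cases hi : i ∈ S
    · obtain ⟨r, hr, h⟩ := Metric.isOpen_iff.1 (hVo i hi) (y i) (h1 i hi)
      exact ⟨r, hr, fun _ => h⟩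
    · exact ⟨1, one_pos, fun h => absurd h hi⟩
  choose r hr h4 using h4
  obtain ⟨d, hd, h5⟩ := exists_pos_le S r (fun i _ => hr i)
  refine ⟨y, min c d, lt_min hc hd, h1, ?_, ?_⟩
  · intro i hi
    exact (Metric.ball_subset_ball ((min_le_right _ _).trans (h5 i hi))).trans (h4 i hi)
  · intro i hi j hj hij
    exact (min_le_left _ _).trans (h3 (i, j) (Finset.mem_offDiag.2 ⟨hi, hj, hij⟩))

/-- A nonempty open set of the region without isolated points is infinite. -/
theorem infinite_of_open {X : Type*} [MetricSpace X] {V : Set X} (hV : IsOpen V)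
    (hne : V.Nonempty) (h : V ⊆ (closure {x : X | IsOpen {x}})ᶜ) : V.Infinite := by
  intro hfin
  obtain ⟨x, hx⟩ := hne
  apply h hx
  apply subset_closure
  have : ({x} : Set X) = V \ (V \ {x}) := by
    ext z
    simp only [mem_singleton_iff, Set.mem_sdiff, not_and, not_not]
    constructor
    · rintro rfl
      exact ⟨hx, fun _ => rfl⟩
    · rintro ⟨h1, h2⟩
      exact h2 h1
  show IsOpen {x}
  rw [this]
  exact hV.sdiff (hfin.subset sdiff_subset).isClosed


abbrev State := Finset (List ℕ) × (List ℕ →₀ ℕ)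

/-- The isolated points. -/
def iso (X : Type*) [MetricSpace X] : Set X := {x : X | IsOpen {x}}

/-- The open set of compacta described by a state. -/
def OS {X : Type*} [MetricSpace X] (W : ℕ → Set X) (s : State) : Set (NonemptyCompacts X) :=
  {K | (∀ l ∈ s.1, W (s.2 l) ⊆ (closure (iso X))ᶜ) ∧
    (K : Set X) ⊆ iso X ∪ ⋃ l ∈ s.1, W (s.2 l) ∧
    ∀ l ∈ s.1, ((K : Set X) ∩ W (s.2 l)).Nonempty}

/-- The data of one double step of the construction. -/
structure Step {X : Type*} [MetricSpace X] (W : ℕ → Set X)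
    (p : Finset (List ℕ) → ℕ → List ℕ) (m : ℕ) (s s' : State)
    (α β : ℕ) (E : List ℕ → Set X) (b b' : ℝ) : Prop where
  hα : 2 + 2 * m * s.1.card ≤ α
  hβ : 1 + (2 * m + 1) * (ch s.1 α).card ≤ β
  hL : s'.1 = ch (ch s.1 α) β
  hb : 0 < b
  hb' : 0 < b'
  hb'm : b' ≤ 1 / ((m : ℝ) + 1)
  hEc : ∀ l ∈ ch s.1 α, IsClosed (E l)
  hEd : ∀ l ∈ ch s.1 α, Metric.diam (E l) ≤ b
  hEs : ∀ l ∈ ch s.1 α, E l ⊆ closure (W (s.2 l.dropLast))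
  hEE : ∀ l ∈ ch s.1 α, ∀ l' ∈ ch s.1 α, l ≠ l' → 2 * b < SetDist (E l) (E l')
  hWne : ∀ l ∈ ch (ch s.1 α) β, (W (s'.2 l)).Nonempty
  hWs : ∀ l ∈ ch (ch s.1 α) β, closure (W (s'.2 l)) ⊆ E l.dropLast
  hWd : ∀ l ∈ ch (ch s.1 α) β, ∀ x ∈ closure (W (s'.2 l)), ∀ y ∈ closure (W (s'.2 l)),
    dist x y ≤ b'
  hWW : ∀ l ∈ ch (ch s.1 α) β, ∀ l' ∈ ch (ch s.1 α) β, l ≠ l' →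
    2 * b' < SetDist (closure (W (s'.2 l))) (closure (W (s'.2 l')))
  hv : ∀ i ∈ ch s.1 α, ∀ j ∈ ch s.1 α, p s.1 α <+: i → ¬ p s.1 α <+: j →
    ∀ u v, u < β → v < β → u ≠ v →
      Metric.diam (⋃ w ∈ Finset.range β, closure (W (s'.2 (j ++ [w])))) <
        SetDist (closure (W (s'.2 (i ++ [u])))) (closure (W (s'.2 (i ++ [v]))))

def Rel {X : Type*} [MetricSpace X] (W : ℕ → Set X)
    (p : Finset (List ℕ) → ℕ → List ℕ) (m : ℕ) (s s' : State) : Prop :=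
  ∃ α β E b b', Step W p m s s' α β E b b'

theorem exists_enum {X : Type*} (F : Finset X) (hF : F.Nonempty) :
    ∃ g : ℕ → X, (∀ u, g u ∈ F) ∧ ∀ x ∈ F, ∃ u < F.card, g u = x := by
  obtain ⟨x0, hx0⟩ := hF
  refine ⟨fun u => if h : u < F.card then (F.equivFin.symm ⟨u, h⟩ : X) else x0, ?_, ?_⟩
  · intro u
    by_cases h : u < F.card
    · simp [h]
    · simpa [h] using hx0
  · intro x hx
    refine ⟨F.equivFin ⟨x, hx⟩, (F.equivFin ⟨x, hx⟩).2, ?_⟩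
    simp

theorem step_dense {X : Type*} [MetricSpace X] [Nonempty X] (W : ℕ → Set X)
    (hWo : ∀ k, IsOpen (W k))
    (hWb : ∀ (x : X) (V : Set X), IsOpen V → x ∈ V → ∃ k, x ∈ W k ∧ W k ⊆ V)
    (p : Finset (List ℕ) → ℕ → List ℕ) (m : ℕ) (s : State)
    (K : NonemptyCompacts X) (hK : K ∈ OS W s) (hfin : (K : Set X).Finite) (ε : ℝ) (hε : 0 < ε) :
    ∃ s', Rel W p m s s' ∧ ∃ K' ∈ OS W s', dist K K' < ε := by
  obtain ⟨L, f⟩ := s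
  obtain ⟨hU, hcov, hmeet⟩ := hK
  simp only at hU hcov hmeet
  set F := hfin.toFinset with hFdef
  have hF : ∀ x, x ∈ F ↔ x ∈ (K : Set X) := by simp [hFdef]
  set α := 2 + 2 * m * L.card + F.card with hα
  have hg : ∀ l, ∃ g : ℕ → X, l ∈ L → (∀ u, g u ∈ (K : Set X) ∧ g u ∈ W (f l)) ∧
      ∀ x ∈ (K : Set X), x ∈ W (f l) → ∃ u < α, g u = x := by
    intro l
    by_cases hl : l ∈ L
    · obtain ⟨x0, hx0, hx0'⟩ := hmeet l hl
      obtain ⟨g, hg1, hg2⟩ := exists_enum (F.filter (· ∈ W (f l)))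
        ⟨x0, by simp [hF, hx0, hx0']⟩
      refine ⟨g, fun _ => ⟨fun u => ?_, fun x hx hx' => ?_⟩⟩
      · have := hg1 u
        simpa [hF] using this
      · obtain ⟨u, hu, hgu⟩ := hg2 x (by simp [hF, hx, hx'])
        have h1 : (F.filter (· ∈ W (f l))).card ≤ F.card := Finset.card_filter_le _ _
        exact ⟨u, by omega, hgu⟩
    · exact ⟨fun _ => Classical.arbitrary X, fun h => absurd h hl⟩
  choose g hg using hg
  set G : List ℕ → X := fun q => g q.dropLast (q.getLast?.getD 0) with hG
  have hGa : ∀ l u, G (l ++ [u]) = g l u := by intro l u; simp [hG]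
  set L1 := ch L α with hL1
  have hd1 : ∀ q ∈ L1, q.dropLast ∈ L := by
    intro q hq
    obtain ⟨l, hl, u, hu, rfl⟩ := mem_ch.1 hq
    simpa using hl
  have hG1 : ∀ q ∈ L1, G q ∈ (K : Set X) ∧ G q ∈ W (f q.dropLast) := by
    intro q hq
    exact (hg _ (hd1 q hq)).1 _
  obtain ⟨y, c, hc, hy, hyc, hyy⟩ := exists_sep L1
    (fun q => W (f q.dropLast) ∩ Metric.ball (G q) (ε / 4)) (by
      intro q hq
      apply infinite_of_open ((hWo _).inter Metric.isOpen_ball)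
      · exact ⟨G q, (hG1 q hq).2, Metric.mem_ball_self (by positivity)⟩
      · exact inter_subset_left.trans (hU _ (hd1 q hq))) (by
      intro q hq
      exact (hWo _).inter Metric.isOpen_ball)
  set β := 1 + (2 * m + 1) * L1.card with hβ
  set L2 := ch L1 β with hL2
  have hd2 : ∀ q ∈ L2, q.dropLast ∈ L1 := by
    intro q hq
    obtain ⟨l, hl, u, hu, rfl⟩ := mem_ch.1 hq
    simpa using hl
  have hUc : ∀ q ∈ L1, Metric.ball (y q) c ⊆ (closure (iso X))ᶜ := fun q hq =>
    (hyc q hq).trans (inter_subset_left.trans (hU _ (hd1 q hq)))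
  have hc8 : ∀ x : X, Metric.ball x (c / 8) ⊆ Metric.ball x c := fun x =>
    Metric.ball_subset_ball (by linarith)
  obtain ⟨z0, δ, hδ, hz0, hz0δ, hz0z0⟩ := exists_sep L2
    (fun q => Metric.ball (y q.dropLast) (c / 8)) (by
      intro q hq
      apply infinite_of_open Metric.isOpen_ball
      · exact ⟨_, Metric.mem_ball_self (by positivity)⟩
      · exact (hc8 _).trans (hUc _ (hd2 q hq))) (by
      intro q hq
      exact Metric.isOpen_ball)
  set V3 : List ℕ → Set X := fun q => if p L α <+: q.dropLast then Metric.ball (z0 q) (δ / 8)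
    else Metric.ball (y q.dropLast) (min (c / 8) (δ / 8)) with hV3
  have hV3s : ∀ q ∈ L2, V3 q ⊆ Metric.ball (y q.dropLast) (c / 8) := by
    intro q hq
    by_cases h : p L α <+: q.dropLast
    · simp only [hV3, h, if_true]
      exact (Metric.ball_subset_ball (by linarith)).trans (hz0δ q hq)
    · simp only [hV3, h, if_false]
      exact Metric.ball_subset_ball (min_le_left _ _)
  have hV3o : ∀ q, IsOpen (V3 q) := by
    intro q
    simp only [hV3]
    split_ifs <;> exact Metric.isOpen_ball
  have hV3n : ∀ q, (V3 q).Nonempty := by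
    intro q
    simp only [hV3]
    split_ifs
    · exact ⟨_, Metric.mem_ball_self (by positivity)⟩
    · exact ⟨_, Metric.mem_ball_self (by positivity)⟩
  have hV3U : ∀ q ∈ L2, V3 q ⊆ (closure (iso X))ᶜ := fun q hq =>
    (hV3s q hq).trans ((hc8 _).trans (hUc _ (hd2 q hq)))
  obtain ⟨z, η, hη, hz, hzη, hzz⟩ := exists_sep L2 V3
    (fun q hq => infinite_of_open (hV3o q) (hV3n q) (hV3U q hq)) (fun q _ => hV3o q)
  obtain ⟨ρ, hρ, hρη, hρδ, hρm⟩ : ∃ ρ > 0, ρ ≤ η / 8 ∧ ρ ≤ δ / 16 ∧ 2 * ρ ≤ 1 / ((m : ℝ) + 1) := by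
    refine ⟨min (η / 8) (min (δ / 16) (1 / ((m : ℝ) + 1) / 2)), by positivity, min_le_left _ _,
      (min_le_right _ _).trans (min_le_left _ _), ?_⟩
    have : min (η / 8) (min (δ / 16) (1 / ((m : ℝ) + 1) / 2)) ≤ 1 / ((m : ℝ) + 1) / 2 :=
      (min_le_right _ _).trans (min_le_right _ _)
    linarith
  have hk : ∀ q, ∃ k, z q ∈ W k ∧ W k ⊆ Metric.ball (z q) ρ := fun q =>
    hWb (z q) _ Metric.isOpen_ball (Metric.mem_ball_self hρ)
  choose k hzk hkρ using hk
  set f' : List ℕ →₀ ℕ := Finsupp.indicator L2 (fun q _ => k q) with hf'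
  have hf'k : ∀ q ∈ L2, f' q = k q := fun q hq => Finsupp.indicator_of_mem hq _
  have hcl : ∀ q, closure (W (k q)) ⊆ Metric.closedBall (z q) ρ := fun q =>
    (closure_mono (hkρ q)).trans Metric.closure_ball_subset_closedBall
  have hcld : ∀ q, ∀ x ∈ closure (W (k q)), dist x (z q) ≤ ρ := fun q x hx =>
    Metric.mem_closedBall.1 (hcl q hx)
  have hclne : ∀ q, (closure (W (k q))).Nonempty := fun q => ⟨z q, subset_closure (hzk q)⟩
  have hclV : ∀ q ∈ L2, closure (W (k q)) ⊆ V3 q := fun q hq x hx =>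
    hzη q hq (Metric.mem_ball.2 ((hcld q x hx).trans_lt (by linarith)))
  have hzG : ∀ q ∈ L2, dist (z q) (G q.dropLast) < ε / 4 := fun q hq =>
    Metric.mem_ball.1 (hyc _ (hd2 q hq) (hc8 _ (hV3s q hq (hz q hq)))).2
  refine ⟨(L2, f'), ⟨α, β, fun q => Metric.closedBall (y q) (c / 8), c / 4, 2 * ρ, ?_⟩, ?_⟩
  · constructor
    · show 2 + 2 * m * L.card ≤ α
      omega
    · exact le_rfl
    · rfl
    · positivity
    · positivity
    · exact hρm
    · intro l hl
      exact Metric.isClosed_closedBall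
    · intro l hl
      refine (Metric.diam_closedBall (by positivity)).trans (by linarith)
    · intro l hl x hx
      apply subset_closure
      exact (hyc l hl (Metric.mem_ball.2 ((Metric.mem_closedBall.1 hx).trans_lt (by linarith)))).1
    · intro l hl l' hl' hne
      have : 3 * c / 4 ≤ SetDist (Metric.closedBall (y l) (c / 8))
          (Metric.closedBall (y l') (c / 8)) := by
        apply le_setDist ⟨_, Metric.mem_closedBall_self (by positivity)⟩
          ⟨_, Metric.mem_closedBall_self (by positivity)⟩
        intro x hx x' hx'
        have h1 := hyy l hl l' hl' hne
        have h2 := dist_triangle4 (y l) x x' (y l')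
        rw [Metric.mem_closedBall, dist_comm] at hx
        rw [Metric.mem_closedBall] at hx'
        linarith
      linarith
    · intro l hl
      rw [hf'k l hl]
      exact ⟨_, hzk l⟩
    · intro l hl
      simp only
      rw [hf'k l hl]
      exact (hclV l hl).trans ((hV3s l hl).trans Metric.ball_subset_closedBall)
    · intro l hl x hx x' hx'
      simp only at hx hx'
      rw [hf'k l hl] at hx hx'
      have h1 := hcld l x hx
      have h2 := hcld l x' hx'
      have := dist_triangle_right x x' (z l)
      linarith
    · intro l hl l' hl' hne
      simp only
      rw [hf'k l hl, hf'k l' hl']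
      have : 6 * ρ ≤ SetDist (closure (W (k l))) (closure (W (k l'))) := by
        apply le_setDist (hclne _) (hclne _)
        intro x hx x' hx'
        have h1 := hzz l hl l' hl' hne
        have h2 := dist_triangle4 (z l) x x' (z l')
        have h3 := hcld l x hx
        have h4 := hcld l' x' hx'
        rw [dist_comm] at h3
        linarith
      linarith
    · intro i hi j hj hpi hpj u v hu hv huv
      simp only at hi hj hpi hpj ⊢
      have hjL : ∀ w < β, j ++ [w] ∈ L2 := fun w hw => append_mem_ch.2 ⟨hj, hw⟩
      have hiL : ∀ w < β, i ++ [w] ∈ L2 := fun w hw => append_mem_ch.2 ⟨hi, hw⟩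
      rw [hf'k _ (hiL u hu), hf'k _ (hiL v hv)]
      have hA : ∀ x ∈ ⋃ w ∈ Finset.range β, closure (W (f' (j ++ [w]))),
          dist x (y j) ≤ δ / 8 := by
        intro x hx
        simp only [mem_iUnion, Finset.mem_range] at hx
        obtain ⟨w, hw, hx⟩ := hx
        rw [hf'k _ (hjL w hw)] at hx
        have := hclV _ (hjL w hw) hx
        simp only [hV3, List.dropLast_concat, hpj, if_false] at this
        exact (Metric.mem_ball.1 this).le.trans (min_le_right _ _)
      have h1 : Metric.diam (⋃ w ∈ Finset.range β, closure (W (f' (j ++ [w])))) ≤ δ / 4 := by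
        apply Metric.diam_le_of_forall_dist_le (by positivity)
        intro x hx x' hx'
        have h1 := hA x hx
        have h2 := hA x' hx'
        have := dist_triangle_right x x' (y j)
        linarith
      have hB : ∀ w < β, ∀ x ∈ closure (W (k (i ++ [w]))), dist x (z0 (i ++ [w])) ≤ δ / 8 := by
        intro w hw x hx
        have := hclV _ (hiL w hw) hx
        simp only [hV3, List.dropLast_concat, hpi, if_true] at this
        exact (Metric.mem_ball.1 this).le
      have h2 : 3 * δ / 4 ≤ SetDist (closure (W (k (i ++ [u])))) (closure (W (k (i ++ [v])))) := by
        apply le_setDist (hclne _) (hclne _)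
        intro x hx x' hx'
        have h1 := hz0z0 _ (hiL u hu) _ (hiL v hv) (by simpa using huv)
        have h2 := dist_triangle4 (z0 (i ++ [u])) x x' (z0 (i ++ [v]))
        have h3 := hB u hu x hx
        have h4 := hB v hv x' hx'
        rw [dist_comm] at h3
        linarith
      linarith
  · have hlift : ∀ x ∈ (K : Set X), x ∉ iso X → ∃ q ∈ L2, dist x (z q) < ε / 4 := by
      intro x hx hxi
      have h := (hcov hx).resolve_left hxi
      simp only [mem_iUnion] at h
      obtain ⟨l, hl, hxl⟩ := h
      obtain ⟨u, hu, hgu⟩ := (hg l hl).2 x hx hxl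
      have h2 : l ++ [u] ++ [0] ∈ L2 :=
        append_mem_ch.2 ⟨append_mem_ch.2 ⟨hl, hu⟩, by omega⟩
      refine ⟨_, h2, ?_⟩
      have := hzG _ h2
      rw [List.dropLast_concat, hGa, hgu] at this
      rwa [dist_comm]
    let T : Set X := ((K : Set X) ∩ iso X) ∪ z '' L2
    have hTf : T.Finite := (hfin.inter_of_left _).union (L2.finite_toSet.image _)
    have hTn : T.Nonempty := by
      obtain ⟨x, hx⟩ := K.nonempty
      by_cases hxi : x ∈ iso X
      · exact ⟨x, Or.inl ⟨hx, hxi⟩⟩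
      · obtain ⟨q, hq, -⟩ := hlift x hx hxi
        exact ⟨z q, Or.inr ⟨q, hq, rfl⟩⟩
    refine ⟨⟨⟨T, hTf.isCompact⟩, hTn⟩, ⟨?_, ?_, ?_⟩, ?_⟩
    · intro l hl
      simp only at hl ⊢
      rw [hf'k l hl]
      exact subset_closure.trans ((hclV l hl).trans (hV3U l hl))
    · rintro x (hx | ⟨q, hq, rfl⟩)
      · exact Or.inl hx.2
      · right
        simp only [mem_iUnion]
        exact ⟨q, hq, by rw [hf'k q hq]; exact hzk q⟩
    · intro l hl
      simp only at hl ⊢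
      rw [hf'k l hl]
      exact ⟨z l, Or.inr ⟨l, hl, rfl⟩, hzk l⟩
    · rw [Metric.NonemptyCompacts.dist_eq]
      refine (Metric.hausdorffDist_le_of_mem_dist (r := ε / 4) (by positivity) ?_ ?_).trans_lt
        (by linarith)
      · intro x hx
        by_cases hxi : x ∈ iso X
        · exact ⟨x, Or.inl ⟨hx, hxi⟩, by simp; positivity⟩
        · obtain ⟨q, hq, h⟩ := hlift x hx hxi
          exact ⟨z q, Or.inr ⟨q, hq, rfl⟩, h.le⟩
      · rintro x (hx | ⟨q, hq, rfl⟩)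
        · exact ⟨x, hx.1, by simp; positivity⟩
        · exact ⟨G q.dropLast, (hG1 _ (hd2 q hq)).1, (hzG q hq).le⟩

theorem isOpen_iso {X : Type*} [MetricSpace X] : IsOpen (iso X) := by
  have : iso X = ⋃ x ∈ iso X, {x} := by simp
  rw [this]
  exact isOpen_biUnion fun x hx => hx

theorem isOpen_OS {X : Type*} [MetricSpace X] (W : ℕ → Set X)
    (hWo : ∀ k, IsOpen (W k)) (s : State) : IsOpen (OS W s) := by
  by_cases h : ∀ l ∈ s.1, W (s.2 l) ⊆ (closure (iso X))ᶜ
  · have : OS W s = {K : NonemptyCompacts X | (K : Set X) ⊆ iso X ∪ ⋃ l ∈ s.1, W (s.2 l)} ∩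
        ⋂ l ∈ s.1, {K : NonemptyCompacts X | ((K : Set X) ∩ W (s.2 l)).Nonempty} := by
      ext K
      simp only [OS, Set.mem_ofPred_eq, mem_inter_iff, mem_iInter]
      exact ⟨fun hh => hh.2, fun hh => ⟨h, hh⟩⟩
    rw [this]
    refine (NonemptyCompacts.isOpen_subsets_of_isOpen
      (isOpen_iso.union (isOpen_biUnion fun _ _ => hWo _))).inter ?_
    exact isOpen_biInter_finset fun l _ => NonemptyCompacts.isOpen_inter_nonempty_of_isOpen (hWo _)
  · have : OS W s = ∅ := by
      ext K
      simp only [OS, Set.mem_ofPred_eq, mem_empty_iff_false, iff_false]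
      exact fun hh => h hh.1
    rw [this]
    exact isOpen_empty

theorem dense_finite_sub {X : Type*} [MetricSpace X] {s : Set X} (hs : Dense s) :
    Dense {K : NonemptyCompacts X | (K : Set X).Finite ∧ ↑K ⊆ s} := by
  intro K
  rw [NonemptyCompacts.closure_finite_subsets]
  simp [hs.closure_eq]

theorem residual_step {X : Type*} [MetricSpace X] [Nonempty X] (W : ℕ → Set X)
    (hWo : ∀ k, IsOpen (W k))
    (hWb : ∀ (x : X) (V : Set X), IsOpen V → x ∈ V → ∃ k, x ∈ W k ∧ W k ⊆ V)
    (p : ℕ → Finset (List ℕ) → ℕ → List ℕ) :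
    {K : NonemptyCompacts X | ∀ m s, K ∈ OS W s → ∃ s', Rel W (p m) m s s' ∧ K ∈ OS W s'} ∈
      residual (NonemptyCompacts X) := by
  have key : ∀ q : ℕ × State, {K : NonemptyCompacts X | K ∈ OS W q.2 →
      ∃ s', Rel W (p q.1) q.1 q.2 s' ∧ K ∈ OS W s'} ∈ residual (NonemptyCompacts X) := by
    rintro ⟨m, s⟩
    set O : Set (NonemptyCompacts X) := ⋃ s' ∈ {s' | Rel W (p m) m s s'}, OS W s' with hO
    have hOo : IsOpen O := isOpen_biUnion fun _ _ => isOpen_OS W hWo _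
    have hsub : OS W s ⊆ closure O := by
      intro K hK
      rw [mem_closure_iff]
      intro V hV hKV
      obtain ⟨K0, ⟨hK0V, hK0s⟩, hK0, -⟩ := (dense_finite_sub (X := X) dense_univ).inter_open_nonempty
        (V ∩ OS W s) (hV.inter (isOpen_OS W hWo s)) ⟨K, hKV, hK⟩
      obtain ⟨ε, hε, hb⟩ := Metric.isOpen_iff.1 hV K0 hK0V
      obtain ⟨s', hs', K', hK', hd⟩ := step_dense W hWo hWb (p m) m s K0 hK0s hK0 ε hε
      refine ⟨K', hb (by rwa [Metric.mem_ball, dist_comm]), ?_⟩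
      simp only [hO, mem_iUnion]
      exact ⟨s', hs', hK'⟩
    have hres : O ∪ (closure O)ᶜ ∈ residual (NonemptyCompacts X) := by
      apply residual_of_dense_open (hOo.union isClosed_closure.isOpen_compl)
      intro K
      rw [closure_union]
      by_cases h : K ∈ closure O
      · exact Or.inl h
      · exact Or.inr (subset_closure h)
    filter_upwards [hres] with K hK hKs
    rcases hK with hK | hK
    · simp only [hO, mem_iUnion] at hK
      obtain ⟨s', h1, h2⟩ := hK
      exact ⟨s', h1, h2⟩
    · exact absurd (hsub hKs) hK
  have := (countable_iInter_mem (l := residual (NonemptyCompacts X))).2 key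
  filter_upwards [this] with K hK m s
  exact mem_iInter.1 hK (m, s)

/-- An enumeration of all lists in which every list occurs infinitely often. -/
def en (m : ℕ) : List ℕ := ((Encodable.decode m.unpair.1 : Option (List ℕ))).getD []

theorem en_surj (l : List ℕ) (N : ℕ) : ∃ m, N ≤ m ∧ en m = l := by
  refine ⟨Nat.pair (Encodable.encode l) N, Nat.right_le_pair _ _, ?_⟩
  simp [en]

noncomputable def pk (m : ℕ) (L : Finset (List ℕ)) (α : ℕ) : List ℕ :=
  if en m ≠ [] ∧ ∃ l ∈ ch L α, en m <+: l then en m else [0]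

theorem balanced_of_chain {X : Type*} [MetricSpace X] (W : ℕ → Set X) (s : ℕ → State)
    (hs0 : (s 0).1 = {[]}) (α β : ℕ → ℕ) (E : ℕ → List ℕ → Set X) (b b' : ℕ → ℝ)
    (hst : ∀ m, Step W (pk m) m (s m) (s (m + 1)) (α m) (β m) (E m) (b m) (b' m))
    (B : Set X) (hBc : IsClosed B)
    (hBcov : ∀ m, B ⊆ ⋃ l ∈ (s m).1, W ((s m).2 l))
    (hBmeet : ∀ m, ∀ l ∈ (s m).1, (B ∩ W ((s m).2 l)).Nonempty) : IsBalanced B := by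
  obtain ⟨a, hae, hao⟩ : ∃ a : ℕ → ℕ, (∀ m, a (2 * m) = α m) ∧ ∀ m, a (2 * m + 1) = β m := by
    refine ⟨fun n => if n % 2 = 0 then α (n / 2) else β (n / 2), ?_, ?_⟩
    · intro m
      simp
    · intro m
      simp [Nat.add_mod, show (2 * m + 1) / 2 = m by omega]
  obtain ⟨C, hCe, hCo⟩ : ∃ C : List ℕ → Set X,
      (∀ m l, l.length = 2 * m → C l = closure (W ((s m).2 l))) ∧
      ∀ m l, l.length = 2 * m + 1 → C l = E m l := by
    refine ⟨fun l => if l.length % 2 = 0 then closure (W ((s (l.length / 2)).2 l))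
      else E (l.length / 2) l, ?_, ?_⟩
    · intro m l hl
      simp [hl]
    · intro m l hl
      simp [hl, Nat.add_mod, show (2 * m + 1) / 2 = m by omega]
  obtain ⟨c, hce, hco⟩ : ∃ c : ℕ → ℝ, (∀ m, c (2 * m + 2) = b' m) ∧ ∀ m, c (2 * m + 1) = b m := by
    refine ⟨fun n => if n % 2 = 0 then b' (n / 2 - 1) else b (n / 2), ?_, ?_⟩
    · intro m
      simp
    · intro m
      simp [Nat.add_mod, show (2 * m + 1) / 2 = m by omega]
  have par : ∀ n, 1 ≤ n → ∃ m, n = 2 * m + 1 ∨ n = 2 * m + 2 := fun n hn =>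
    ⟨(n - 1) / 2, by omega⟩
  have hsL : ∀ m, (s m).1 = VL a (2 * m) := by
    intro m
    induction m with
    | zero => simp [hs0, VL]
    | succ m ih =>
      rw [(hst m).hL, ih, ← hae m, ← hao m]
      rfl
  have hL1 : ∀ m, ch (s m).1 (α m) = VL a (2 * m + 1) := by
    intro m
    rw [hsL, ← hae m]
    rfl
  have hL2 : ∀ m, ch (ch (s m).1 (α m)) (β m) = VL a (2 * m + 2) := by
    intro m
    rw [hL1, ← hao m]
    rfl
  have ha1 : ∀ k, 1 ≤ a k := by
    intro k
    obtain ⟨m, h | h⟩ : ∃ m, k = 2 * m ∨ k = 2 * m + 1 := ⟨k / 2, by omega⟩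
    · rw [h, hae]
      have := (hst m).hα
      omega
    · rw [h, hao]
      have := (hst m).hβ
      omega
  -- even level sets, indexed by the step producing them
  have hCe' : ∀ m l, l.length = 2 * m + 2 → C l = closure (W ((s (m + 1)).2 l)) := fun m l hl =>
    hCe (m + 1) l (by omega)
  have hnest : ∀ l x, ValidIdx a (l ++ [x]) → 1 ≤ l.length → C (l ++ [x]) ⊆ C l := by
    intro l x hv hl
    obtain ⟨m, h | h⟩ := par _ hl
    · have hm : l ++ [x] ∈ VL a (2 * m + 2) := mem_VL.2 ⟨hv, by simp [h]⟩
      rw [hCe' m (l ++ [x]) (by simp [h]), hCo m l h]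
      rw [← hL2] at hm
      simpa using (hst m).hWs _ hm
    · have hm : l ++ [x] ∈ VL a (2 * (m + 1) + 1) := mem_VL.2 ⟨hv, by simp [h]; omega⟩
      rw [hCo (m + 1) (l ++ [x]) (by simp [h]; omega), hCe (m + 1) l (by omega)]
      rw [← hL1] at hm
      simpa using (hst (m + 1)).hEs _ hm
  have hneE : ∀ m l, ValidIdx a l → l.length = 2 * m + 2 → (C l).Nonempty := by
    intro m l hv hl
    have hm : l ∈ VL a (2 * m + 2) := mem_VL.2 ⟨hv, hl⟩
    rw [← hL2] at hm
    rw [hCe' m l hl]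
    exact ((hst m).hWne l hm).mono subset_closure
  have hne : ∀ l, ValidIdx a l → 1 ≤ l.length → (C l).Nonempty := by
    intro l hv hl
    obtain ⟨m, h | h⟩ := par _ hl
    · have hv' : ValidIdx a (l ++ [0]) := valid_append.2 ⟨hv, ha1 _⟩
      exact (hneE m _ hv' (by simp [h])).mono (hnest l 0 hv' hl)
    · exact hneE m l hv h
  have hpos : ∀ n, 1 ≤ n → 0 < c n := by
    intro n hn
    obtain ⟨m, h | h⟩ := par _ hn
    · rw [h, hco]; exact (hst m).hb
    · rw [h, hce]; exact (hst m).hb'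
  have hsep : ∀ l l', ValidIdx a l → ValidIdx a l' → 1 ≤ l.length → l.length = l'.length →
      l ≠ l' → 2 * c l.length < SetDist (C l) (C l') := by
    intro l l' hv hv' hl hll hne
    obtain ⟨m, h | h⟩ := par _ hl
    · rw [hCo m l h, hCo m l' (hll ▸ h), h, hco]
      refine (hst m).hEE l ?_ l' ?_ hne
      · rw [hL1]; exact mem_VL.2 ⟨hv, h⟩
      · rw [hL1]; exact mem_VL.2 ⟨hv', hll ▸ h⟩
    · rw [hCe' m l h, hCe' m l' (hll ▸ h), h, hce]
      refine (hst m).hWW l ?_ l' ?_ hne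
      · rw [hL2]; exact mem_VL.2 ⟨hv, h⟩
      · rw [hL2]; exact mem_VL.2 ⟨hv', hll ▸ h⟩
  have hpre : ∀ q l, q <+: l → ValidIdx a l → 1 ≤ q.length → C l ⊆ C q := by
    rintro q l ⟨t, rfl⟩ hv hq
    induction t using List.reverseRecOn with
    | nil => simp
    | append_singleton t x ih =>
      rw [← List.append_assoc] at hv ⊢
      exact (hnest _ x hv (by simp; omega)).trans (ih (valid_append.1 hv).1)
  have hpre' : ∀ q l, ValidIdx a q → ValidIdx a l → 1 ≤ q.length → q.length ≤ l.length →
      C l ⊆ C q → q <+: l := by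
    intro q l hvq hvl hq hql hsub
    by_contra hnp
    have h1 : l.take q.length <+: l := List.take_prefix _ _
    have h2 : (l.take q.length).length = q.length := by simp [hql]
    have hv2 := valid_prefix h1 hvl
    have h3 : l.take q.length ≠ q := fun h => hnp (h ▸ h1)
    have h4 := hsep _ q hv2 hvq (by omega) h2 h3
    have h5 := hpos (l.take q.length).length (by omega)
    obtain ⟨x, hx⟩ := hne l hvl (by omega)
    exact disj_of_setDist (by linarith) x (hpre _ l h1 hvl (by omega) hx) (hsub hx)
  have hΦ : ∀ m, ValidIdx a (pk m (s m).1 (α m)) ∧ 1 ≤ (pk m (s m).1 (α m)).length ∧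
      (pk m (s m).1 (α m)).length ≤ 2 * m + 1 := by
    intro m
    unfold pk
    split_ifs with h
    · obtain ⟨h1, l, hl, h2⟩ := h
      rw [hL1, mem_VL] at hl
      refine ⟨valid_prefix h2 hl.1, List.length_pos_iff.2 h1, ?_⟩
      rw [← hl.2]
      exact h2.length_le
    · refine ⟨?_, by simp, by simp⟩
      have := (valid_append (a := a) (l := []) (x := 0)).2 ⟨valid_nil, ha1 _⟩
      simpa using this
  refine ⟨a, C, c, fun m => pk m (s m).1 (α m), ha1, ?_, ?_, ?_, hnest, hpos, ?_, hsep, hΦ, ?_,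
    ?_, ?_⟩
  · have h1 := hae 0
    have h2 := (hst 0).hα
    simp at h1
    omega
  · intro k hk
    rw [← card_VL]
    obtain ⟨m, h | h⟩ : ∃ m, k = 2 * m ∨ k = 2 * m + 1 := ⟨k / 2, by omega⟩
    · have := (hst m).hα
      rw [h, hae, ← hsL]
      omega
    · have := (hst m).hβ
      rw [h, hao, ← hL1]
      omega
  · intro l hv hl
    refine ⟨hne l hv hl, ?_⟩
    obtain ⟨m, h | h⟩ := par _ hl
    · rw [hCo m l h]
      refine (hst m).hEc l ?_
      rw [hL1]; exact mem_VL.2 ⟨hv, h⟩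
    · rw [hCe' m l h]
      exact isClosed_closure
  · intro l hv hl
    obtain ⟨m, h | h⟩ := par _ hl
    · rw [hCo m l h, h, hco]
      refine (hst m).hEd l ?_
      rw [hL1]; exact mem_VL.2 ⟨hv, h⟩
    · rw [hCe' m l h, h, hce]
      refine Metric.diam_le_of_forall_dist_le (hst m).hb'.le ((hst m).hWd l ?_)
      rw [hL2]; exact mem_VL.2 ⟨hv, h⟩
  · intro l hv hl
    obtain ⟨m, hm, hem⟩ := en_surj l l.length
    refine ⟨m, ?_⟩
    have hcond : en m ≠ [] ∧ ∃ q ∈ ch (s m).1 (α m), en m <+: q := by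
      refine ⟨?_, l ++ List.replicate (2 * m + 1 - l.length) 0, ?_, ?_⟩
      · rw [hem]; exact List.length_pos_iff.1 hl
      · rw [hL1, mem_VL]
        refine ⟨valid_extend ha1 hv _, ?_⟩
        simp; omega
      · rw [hem]; exact List.prefix_append _ _
    show pk m (s m).1 (α m) = l
    unfold pk
    rw [if_pos hcond, hem]
  · intro m i j hvi hvj hli hlj hi hj u v hu hv huv
    simp only at hi hj
    obtain ⟨h1, h2, h3⟩ := hΦ m
    have hpi := hpre' _ i h1 hvi h2 (by omega) hi
    have hpj : ¬ pk m (s m).1 (α m) <+: j := fun h => hj (hpre _ j h hvj h2)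
    rw [hao] at hu hv ⊢
    have := (hst m).hv i (by rw [hL1]; exact mem_VL.2 ⟨hvi, hli⟩)
      j (by rw [hL1]; exact mem_VL.2 ⟨hvj, hlj⟩) hpi hpj u v hu hv huv
    rw [hCe' m (i ++ [u]) (by simp [hli]), hCe' m (i ++ [v]) (by simp [hli])]
    have hC : ∀ w, C (j ++ [w]) = closure (W ((s (m + 1)).2 (j ++ [w]))) := fun w =>
      hCe' m (j ++ [w]) (by simp [hlj])
    simp only [hC]
    exact this
  · have hcovE : ∀ m, ∀ x ∈ B, ∃ l, ValidIdx a l ∧ l.length = 2 * m + 2 ∧ x ∈ C l := by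
      intro m x hx
      have := hBcov (m + 1) hx
      simp only [mem_iUnion] at this
      obtain ⟨l, hl, hxl⟩ := this
      rw [hsL, mem_VL] at hl
      refine ⟨l, hl.1, by omega, ?_⟩
      rw [hCe (m + 1) l hl.2]
      exact subset_closure hxl
    ext x
    simp only [mem_iInter, mem_iUnion, Set.mem_ofPred_eq, exists_prop]
    constructor
    · intro hx n
      obtain ⟨m, h | h⟩ := par (n + 1) (by omega)
      · obtain ⟨l, hv, hl, hxl⟩ := hcovE m x hx
        rcases List.eq_nil_or_concat l with rfl | ⟨q, u, rfl⟩
        · simp at hl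
        · rw [List.concat_eq_append] at hv hl hxl
          have hq : q.length = 2 * m + 1 := by simpa using hl
          exact ⟨q, ⟨(valid_append.1 hv).1, by omega⟩, hnest q u hv (by omega) hxl⟩
      · obtain ⟨l, hv, hl, hxl⟩ := hcovE m x hx
        exact ⟨l, ⟨hv, by omega⟩, hxl⟩
    · intro hx
      rw [← hBc.closure_eq, Metric.mem_closure_iff]
      intro ε hε
      obtain ⟨m, hm⟩ := exists_nat_one_div_lt hε
      obtain ⟨l, ⟨hv, hl⟩, hxl⟩ := hx (2 * m + 1)
      have hlm : l ∈ VL a (2 * m + 2) := mem_VL.2 ⟨hv, hl⟩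
      have hls : l ∈ (s (m + 1)).1 := by rw [hsL]; exact hlm
      obtain ⟨y, hyB, hyW⟩ := hBmeet (m + 1) l hls
      refine ⟨y, hyB, ?_⟩
      rw [hCe' m l hl] at hxl
      rw [← hL2] at hlm
      have h1 := (hst m).hWd l hlm x hxl y (subset_closure hyW)
      have h2 := (hst m).hb'm
      linarith

end BalGen

/-- In a Polish space, the generic non-empty compact set can be written as the union of a
balanced compact set (or the empty set) and a finite set. -/
theorem generic_compact_balanced_union_finite
    {X : Type*} [MetricSpace X] [CompleteSpace X] [SeparableSpace X] :
    {K : NonemptyCompacts X | ∃ B F : Set X,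
        (B = ∅ ∨ (IsCompact B ∧ IsBalanced B)) ∧ F.Finite ∧ (K : Set X) = B ∪ F} ∈
      residual (NonemptyCompacts X) := by
  rcases isEmpty_or_nonempty X with hX | hX
  · have : IsEmpty (NonemptyCompacts X) := ⟨fun K => hX.elim K.nonempty.some⟩
    convert Filter.univ_mem
    ext K
    exact this.elim K
  have : SecondCountableTopology X := UniformSpace.secondCountable_of_separable X
  set D : Set X := BalGen.iso X with hD
  set U : Set X := (closure D)ᶜ with hU
  have hUo : IsOpen U := isClosed_closure.isOpen_compl
  have hDU : ∀ x ∈ D, x ∉ U := fun x hx hxU => hxU (subset_closure hx)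
  obtain ⟨W, hW⟩ : ∃ W : ℕ → Set X, insert U (countableBasis X) = range W :=
    ((countable_countableBasis X).insert U).exists_eq_range ⟨U, mem_insert _ _⟩
  have hWo : ∀ k, IsOpen (W k) := by
    intro k
    have : W k ∈ insert U (countableBasis X) := hW ▸ mem_range_self k
    rcases this with h | h
    · rw [h]; exact hUo
    · exact isOpen_of_mem_countableBasis h
  have hWb : ∀ (x : X) (V : Set X), IsOpen V → x ∈ V → ∃ k, x ∈ W k ∧ W k ⊆ V := by
    intro x V hV hx
    obtain ⟨B, hB, hxB, hBV⟩ := (isBasis_countableBasis X).exists_subset_of_mem_open hx hV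
    have : B ∈ range W := hW ▸ mem_insert_of_mem _ hB
    obtain ⟨k, rfl⟩ := this
    exact ⟨k, hxB, hBV⟩
  obtain ⟨k0, hk0⟩ : U ∈ range W := hW ▸ mem_insert _ _
  have hdense : Dense (D ∪ U) := by
    intro x
    rw [closure_union]
    by_cases h : x ∈ closure D
    · exact Or.inl h
    · exact Or.inr (subset_closure h)
  have hres0 : {K : NonemptyCompacts X | (K : Set X) ⊆ D ∪ U} ∈ residual (NonemptyCompacts X) := by
    apply residual_of_dense_open
    · exact NonemptyCompacts.isOpen_subsets_of_isOpen (BalGen.isOpen_iso.union hUo)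
    · exact (BalGen.dense_finite_sub hdense).mono fun K hK => hK.2
  filter_upwards [hres0, BalGen.residual_step W hWo hWb BalGen.pk] with K hK hstep
  have hBe : (K : Set X) ∩ U = (K : Set X) ∩ Dᶜ := by
    ext x
    constructor
    · rintro ⟨h1, h2⟩
      exact ⟨h1, fun h => hDU x h h2⟩
    · rintro ⟨h1, h2⟩
      exact ⟨h1, (hK h1).resolve_left h2⟩
  have hBc : IsCompact ((K : Set X) ∩ U) := by
    rw [hBe]
    exact K.isCompact.inter_right BalGen.isOpen_iso.isClosed_compl
  have hFin : ((K : Set X) ∩ D).Finite := by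
    have hFe : (K : Set X) ∩ D = (K : Set X) ∩ Uᶜ := by
      ext x
      constructor
      · rintro ⟨h1, h2⟩
        exact ⟨h1, hDU x h2⟩
      · rintro ⟨h1, h2⟩
        exact ⟨h1, (hK h1).resolve_right h2⟩
    have hc : IsCompact ((K : Set X) ∩ D) := by
      rw [hFe]
      exact K.isCompact.inter_right hUo.isClosed_compl
    obtain ⟨t, ht, htf, hcov⟩ := hc.elim_finite_subcover_image (b := D) (c := fun x => {x})
      (fun x hx => hx) (fun x hx => by simpa using hx.2)
    refine htf.subset (fun x hx => ?_)
    have := hcov hx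
    simpa using this
  refine ⟨(K : Set X) ∩ U, (K : Set X) ∩ D, ?_, hFin, ?_⟩
  · rcases ((K : Set X) ∩ U).eq_empty_or_nonempty with he | hne
    · exact Or.inl he
    right
    refine ⟨hBc, ?_⟩
    let s0 : BalGen.State := ({[]}, Finsupp.single [] k0)
    have hs0 : K ∈ BalGen.OS W s0 := by
      refine ⟨?_, ?_, ?_⟩
      · intro l hl
        have : l = [] := by simpa [s0] using hl
        subst this
        simp [s0, hk0, hU, hD]
      · intro x hx
        simpa [s0, hk0] using hK hx
      · intro l hl
        have : l = [] := by simpa [s0] using hl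
        subst this
        simpa [s0, hk0] using hne
    choose nx hnx1 hnx2 using hstep
    let S : ℕ → {s : BalGen.State // K ∈ BalGen.OS W s} := fun n =>
      Nat.rec ⟨s0, hs0⟩ (fun m s => ⟨nx m s.1 s.2, hnx2 m s.1 s.2⟩) n
    have hrel : ∀ m, BalGen.Rel W (BalGen.pk m) m (S m).1 (S (m + 1)).1 := fun m =>
      hnx1 m (S m).1 (S m).2
    choose α β E b b' hst using hrel
    refine BalGen.balanced_of_chain W (fun m => (S m).1) rfl α β E b b' hst _ hBc.isClosed ?_ ?_
    · intro m x hx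
      exact ((S m).2.2.1 hx.1).resolve_left fun h => hDU x h hx.2
    · intro m l hl
      obtain ⟨x, hxK, hxW⟩ := (S m).2.2.2 l hl
      exact ⟨x, ⟨hxK, (S m).2.1 l hl hxW⟩, hxW⟩
  · ext x
    constructor
    · intro hx
      rcases hK hx with h | h
      · exact Or.inr ⟨hx, h⟩
      · exact Or.inl ⟨hx, h⟩
    · rintro (h | h)
      · exact h.1
      · exact h.1
end
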